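/- Every mass distribution μ on ℝ⁷ admits an equipartition into 20 = 5×2×2 boxes by a collection of 4 parallel hyperplanes and two additional non-parallel hyperplanes: there exist a unit vector u ∈ ℝ⁷, real numbers t_1 < t_2 < t_3 < t_4, unit vectors v and w, and real numbers s₁, s₂, with u, v, w pairwise non-parallel (no two equal up to sign), such that each of the 20 regions {x : t_i < ⟨x,u⟩ < t_{i+1}} ∩ {x : ⟨x,v⟩ ≶ s₁} ∩ {x : ⟨x,w⟩ ≶ s₂} (for 0 ≤ i ≤ 4, with t_0 = -∞, t_5 = +∞, and all four sign choices) has μ-measure μ(ℝ⁷)/20. -/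

import Mathlib

open MeasureTheory

/-- The open slab between consecutive parallel hyperplanes orthogonal to `u`:
for `0 ≤ i ≤ n`, the region `{x : t i < ⟪x,u⟫ < t (i+1)}`, with the conventions
`t 0 = -∞` and `t (n+1) = +∞` (i.e. the corresponding inequality is dropped). -/
noncomputable def slab {d : ℕ} (u : EuclideanSpace ℝ (Fin d)) (t : ℕ → ℝ) (n i : ℕ) :
    Set (EuclideanSpace ℝ (Fin d)) :=
  {x | (1 ≤ i → t i < (inner ℝ x u : ℝ)) ∧ (i + 1 ≤ n → (inner ℝ x u : ℝ) < t (i + 1))}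

/-- The open halfspace below (`b = true`) or above (`b = false`) the hyperplane
orthogonal to `v` at level `s`. -/
def halfSp {d : ℕ} (v : EuclideanSpace ℝ (Fin d)) (s : ℝ) (b : Bool) :
    Set (EuclideanSpace ℝ (Fin d)) :=
  if b then {x | (inner ℝ x v : ℝ) < s} else {x | s < (inner ℝ x v : ℝ)}



namespace EQ

/-- mod 2 coboundary on (augmented) Alexander-Spanier cochains -/
def dl {X : Type*} : (List X → ZMod 2) → List X → ZMod 2
  | _, [] => 0
  | c, x :: l => c l + dl (fun m => c (x :: m)) l

theorem two_self (a : ZMod 2) : a + a = 0 := CharTwo.add_self_eq_zero a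

theorem dl_add {X : Type*} (c c' : List X → ZMod 2) (l : List X) :
    dl (c + c') l = dl c l + dl c' l := by
  induction l generalizing c c' with
  | nil => simp [dl]
  | cons x l ih =>
    have := ih (fun m => c (x :: m)) (fun m => c' (x :: m))
    simp only [dl, Pi.add_apply]
    have e : (fun m => c (x :: m) + c' (x :: m)) =
      (fun m => c (x :: m)) + (fun m => c' (x :: m)) := rfl
    rw [e, this]; ring

theorem dl_smul {X : Type*} (a : ZMod 2) (c : List X → ZMod 2) (l : List X) :
    dl (fun m => a * c m) l = a * dl c l := by
  induction l generalizing c with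
  | nil => simp [dl]
  | cons x l ih =>
    have := ih (fun m => c (x :: m))
    simp only [dl]
    rw [this]; ring

theorem dl_map {X Y : Type*} (g : X → Y) (c : List Y → ZMod 2) (l : List X) :
    dl (fun m => c (m.map g)) l = dl c (l.map g) := by
  induction l generalizing c with
  | nil => simp [dl]
  | cons x l ih =>
    have := ih (fun m => c (g x :: m))
    simp only [dl, List.map_cons]
    rw [this]

/-- prism operator -/
def pr {X Y : Type*} (φ ψ : X → Y) : (List Y → ZMod 2) → List X → ZMod 2
  | _, [] => 0
  | c, x :: l => c (φ x :: ψ x :: l.map ψ) + pr φ ψ (fun m => c (φ x :: m)) l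

theorem pr_add {X Y : Type*} (φ ψ : X → Y) (c c' : List Y → ZMod 2) (l : List X) :
    pr φ ψ (c + c') l = pr φ ψ c l + pr φ ψ c' l := by
  induction l generalizing c c' with
  | nil => simp [pr]
  | cons x l ih =>
    have := ih (fun m => c (φ x :: m)) (fun m => c' (φ x :: m))
    simp only [pr, Pi.add_apply]
    have e : (fun m => c (φ x :: m) + c' (φ x :: m)) =
      (fun m => c (φ x :: m)) + (fun m => c' (φ x :: m)) := rfl
    rw [e, this]; ring

theorem pr_congr {X Y : Type*} (φ ψ : X → Y) (c c' : List Y → ZMod 2) (l : List X)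
    (h : ∀ m : List Y, (∀ y ∈ m, ∃ x ∈ l, y = φ x ∨ y = ψ x) → c m = c' m) :
    pr φ ψ c l = pr φ ψ c' l := by
  induction l generalizing c c' with
  | nil => simp [pr]
  | cons x l ih =>
    simp only [pr]
    rw [ih (fun m => c (φ x :: m)) (fun m => c' (φ x :: m))]
    · rw [h]
      intro y hy
      simp only [List.mem_cons, List.mem_map] at hy
      rcases hy with rfl | rfl | ⟨a, ha, rfl⟩
      · exact ⟨x, by simp, by simp⟩
      · exact ⟨x, by simp, by simp⟩
      · exact ⟨a, by simp [ha], by simp⟩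
    · intro m hm
      apply h
      intro y hy
      rcases List.mem_cons.1 hy with rfl | hy
      · exact ⟨x, by simp, by simp⟩
      · obtain ⟨a, ha, h2⟩ := hm y hy
        exact ⟨a, by simp [ha], h2⟩

theorem prism {X Y : Type*} (φ ψ : X → Y) (c : List Y → ZMod 2) (l : List X) :
    dl (pr φ ψ c) l + pr φ ψ (dl c) l = c (l.map ψ) + c (l.map φ) := by
  induction l generalizing c with
  | nil => simp [dl, pr, two_self]
  | cons x l ih =>
    have h1 := ih (fun m => c (φ x :: m))
    simp only [dl, pr, List.map_cons]
    have e1 : (fun m : List X => c (φ x :: ψ x :: m.map ψ) + pr φ ψ (fun n => c (φ x :: n)) m)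
      = (fun m : List X => c (φ x :: ψ x :: m.map ψ)) + pr φ ψ (fun n => c (φ x :: n)) := rfl
    have e2 : (fun m : List Y => c m + dl (fun n => c (φ x :: n)) m) =
      c + dl (fun n => c (φ x :: n)) := rfl
    rw [e1, e2, dl_add, pr_add, dl_map ψ (fun m => c (φ x :: ψ x :: m))]
    linear_combination h1 + two_self (pr φ ψ c l) + two_self (c (φ x :: l.map ψ)) +
      two_self (dl (fun m => c (φ x :: ψ x :: m)) (l.map ψ))

/-- mod 2 chains as functionals on cochains -/
abbrev Fn (X : Type*) := (List X → ZMod 2) →+ ZMod 2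

def Supp {X : Type*} (L : Fn X) (S : List X → Prop) : Prop :=
  ∀ c c' : List X → ZMod 2, (∀ l, S l → c l = c' l) → L c = L c'

def pull {X : Type*} (g : X → X) (L : Fn X) : Fn X where
  toFun c := L (fun l => c (l.map g))
  map_zero' := by exact L.map_zero
  map_add' c c' := by rw [← L.map_add]; rfl

def prF {X : Type*} (φ ψ : X → X) (L : Fn X) : Fn X where
  toFun c := L (pr φ ψ c)
  map_zero' := by
    have : pr φ ψ (0 : List X → ZMod 2) = 0 := by
      have h : pr φ ψ ((0 : List X → ZMod 2) + 0) = _ := funext (pr_add φ ψ 0 0)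
      funext l
      have := congrFun h l
      rw [add_zero] at this
      simpa using this
    rw [this]; exact L.map_zero
  map_add' c c' := by
    rw [← L.map_add]; congr 1; funext l; exact pr_add _ _ _ _ _

def cone {X : Type*} (p : X) (L : Fn X) : Fn X where
  toFun c := L (fun l => c (p :: l))
  map_zero' := by exact L.map_zero
  map_add' c c' := by rw [← L.map_add]; rfl

def sml {E : Type*} [NormedAddCommGroup E] (D : Set E) (ε : ℝ) (l : List E) : Prop :=
  (∀ x ∈ l, x ∈ D) ∧ ∀ x ∈ l, ∀ y ∈ l, ‖x - y‖ ≤ ε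

theorem fill {E : Type*} [NormedAddCommGroup E] [NormedSpace ℝ E] (D : Set E) (p : E)
    (hp : p ∈ D) (hst : ∀ x ∈ D, ∀ t : ℝ, 0 ≤ t → t ≤ 1 → x + t • (p - x) ∈ D)
    (R : ℝ) (hR : ∀ x ∈ D, ‖p - x‖ ≤ R) (ε ε' : ℝ) (h0 : 0 ≤ ε) (hε : ε < ε')
    (L : Fn E) (hL : ∀ c, L (dl c) = 0) (hS : Supp L (sml D ε)) :
    ∃ M : Fn E, Supp M (sml D ε') ∧ ∀ c, M (dl c) = L c := by
  obtain ⟨N, hN⟩ := exists_nat_gt (R / (ε' - ε))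
  have hpos : 0 < ε' - ε := by linarith
  have hR0 : 0 ≤ R := le_trans (norm_nonneg _) (hR p hp)
  have hN0 : (0 : ℝ) < N := lt_of_le_of_lt (by positivity) hN
  have hRN : R / N ≤ ε' - ε := by
    rw [div_lt_iff₀ hpos] at hN
    rw [div_le_iff₀ hN0]; linarith
  let H : ℕ → E → E := fun i x => x + ((i : ℝ) / N) • (p - x)
  have hHD : ∀ i ≤ N, ∀ x ∈ D, H i x ∈ D := by
    intro i hi x hx
    apply hst x hx _ (by positivity)
    rw [div_le_one hN0]; exact_mod_cast hi
  have hH1 : ∀ i ≤ N, ∀ x y, ‖H i x - H i y‖ ≤ ‖x - y‖ := by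
    intro i hi x y
    have : H i x - H i y = (1 - (i : ℝ) / N) • (x - y) := by
      simp only [H]; module
    rw [this, norm_smul]
    have h1 : (i : ℝ) / N ≤ 1 := by rw [div_le_one hN0]; exact_mod_cast hi
    have h2 : 0 ≤ (i : ℝ) / N := by positivity
    rw [Real.norm_of_nonneg (by linarith)]
    nlinarith [norm_nonneg (x - y)]
  have hH2 : ∀ i x, x ∈ D → ‖H (i + 1) x - H i x‖ ≤ R / N := by
    intro i x hx
    have : H (i + 1) x - H i x = (1 / (N : ℝ)) • (p - x) := by
      simp only [H]; push_cast; module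
    rw [this, norm_smul, Real.norm_of_nonneg (by positivity)]
    calc 1 / (N : ℝ) * ‖p - x‖ ≤ 1 / (N : ℝ) * R := by gcongr; exact hR x hx
      _ = R / N := by ring
  have key : ∀ j ≤ N, ∃ M : Fn E, Supp M (sml D ε') ∧ ∀ c, M (dl c) = pull (H (N - j)) L c := by
    intro j
    induction j with
    | zero =>
      intro _
      refine ⟨cone p (pull (H N) L), ?_, ?_⟩
      · intro c c' h
        apply hS
        intro l hl
        have hHp : ∀ x, H N x = p := by
          intro x; simp only [H]; rw [div_self hN0.ne']; module
        apply h
        constructor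
        · intro x hx
          simp only [List.mem_cons, List.mem_map, hHp] at hx
          rcases hx with rfl | ⟨_, _, rfl⟩ <;> exact hp
        · intro x hx y hy
          simp only [List.mem_cons, List.mem_map, hHp] at hx hy
          have hx' : x = p := by rcases hx with rfl | ⟨_, _, rfl⟩ <;> rfl
          have hy' : y = p := by rcases hy with rfl | ⟨_, _, rfl⟩ <;> rfl
          rw [hx', hy']; simp; linarith
      · intro c
        have : cone p (pull (H N) L) (dl c) =
          L ((fun l => c (l.map (H N))) + dl (fun l => c (p :: l.map (H N)))) := by
          change L _ = L _
          congr 1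
          funext l
          simp only [dl, Pi.add_apply]
          rw [dl_map (H N) (fun m => c (p :: m))]
        rw [this, L.map_add, hL, add_zero]; rfl
    | succ j ih =>
      intro hj
      obtain ⟨M, hM1, hM2⟩ := ih (by omega)
      set i := N - (j + 1) with hi
      have hij : N - j = i + 1 := by omega
      rw [hij] at hM2
      refine ⟨M + prF (H i) (H (i + 1)) L, ?_, ?_⟩
      · intro c c' h
        simp only [AddMonoidHom.add_apply]
        rw [hM1 c c' h]
        congr 1
        apply hS
        intro l hl
        apply pr_congr
        intro m hm
        apply h
        constructor
        · intro y hy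
          obtain ⟨x, hx, rfl | rfl⟩ := hm y hy
          · exact hHD _ (by omega) _ (hl.1 x hx)
          · exact hHD _ (by omega) _ (hl.1 x hx)
        · intro y hy y' hy'
          obtain ⟨x, hx, h1⟩ := hm y hy
          obtain ⟨x', hx', h2⟩ := hm y' hy'
          have hxx := hl.2 x hx x' hx'
          have a1 := hH1 i (by omega) x x'
          have a2 := hH1 (i + 1) (by omega) x x'
          have a3 := hH2 i x (hl.1 x hx)
          have a4 := hH2 i x' (hl.1 x' hx')
          rcases h1 with rfl | rfl <;> rcases h2 with rfl | rfl
          · linarith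
          · have := norm_sub_le_norm_sub_add_norm_sub (H i x) (H i x') (H (i+1) x')
            rw [norm_sub_rev (H i x')] at this
            linarith
          · have := norm_sub_le_norm_sub_add_norm_sub (H (i+1) x) (H i x) (H i x')
            linarith
          · linarith
      · intro c
        simp only [AddMonoidHom.add_apply]
        rw [hM2]
        change L _ + L _ = L _
        have e : (pr (H i) (H (i + 1)) (dl c)) =
          dl (pr (H i) (H (i + 1)) c) + ((fun l => c (l.map (H (i+1)))) + (fun l => c (l.map (H i)))) := by
          funext l
          have := prism (H i) (H (i + 1)) c l
          simp only [Pi.add_apply]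
          linear_combination this - two_self (dl (pr (H i) (H (i + 1)) c) l)
        rw [e, L.map_add, L.map_add, hL]
        linear_combination two_self (L (fun l => c (l.map (H (i+1)))))
  obtain ⟨M, h1, h2⟩ := key N le_rfl
  refine ⟨M, h1, fun c => ?_⟩
  rw [h2]
  change L _ = L _
  congr 1
  funext l
  have : H (N - N) = id := by funext x; simp [H]
  rw [this]; simp

def cupS {X : Type*} (s : X → ZMod 2) (c : List X → ZMod 2) : List X → ZMod 2
  | [] => 0
  | x :: l => s x * c (x :: l)

def K {X : Type*} : List ((X → ZMod 2) × (Fin 3 → ZMod 2)) → List X → ZMod 2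
  | [], [_] => 1
  | [], _ => 0
  | q :: ss, x :: y :: l => (q.1 x + q.1 y) * K ss (y :: l)
  | _ :: _, _ => 0

theorem dl_zero' {X : Type*} (l : List X) : dl (fun _ : List X => (0 : ZMod 2)) l = 0 := by
  have := dl_smul 0 (fun _ : List X => (0 : ZMod 2)) l
  simpa using this

theorem dl_cup {X : Type*} (s : X → ZMod 2) (c : List X → ZMod 2) (x y : X) (l : List X)
    (hc : dl c (x :: y :: l) = 0) :
    dl (cupS s c) (x :: y :: l) = (s x + s y) * c (y :: l) := by
  simp only [dl, cupS] at hc ⊢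
  rw [dl_smul]
  linear_combination (s x) * hc - s x * two_self (c (y :: l))

theorem dl_dl {X : Type*} (c : List X → ZMod 2) (l : List X) : dl (dl c) l = 0 := by
  induction l generalizing c with
  | nil => rfl
  | cons x l ih =>
    have h := ih (fun m => c (x :: m))
    simp only [dl]
    have e : (fun m => c m + dl (fun n => c (x :: n)) m) = c + dl (fun n => c (x :: n)) := rfl
    rw [e, dl_add, h]
    linear_combination two_self (dl c l)

theorem K_cons {X : Type*} (q : (X → ZMod 2) × (Fin 3 → ZMod 2)) (ss) (h : dl (K ss) = 0) :
    K (q :: ss) = dl (cupS q.1 (K ss)) := by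
  funext l
  match l with
  | [] => simp [K, dl]
  | [x] => simp [K, dl, cupS]
  | x :: y :: l =>
    rw [dl_cup]
    · simp [K]
    · exact congrFun h _

theorem K_nil {X : Type*} (x : X) (l : List X) : 
    K ([] : List ((X → ZMod 2) × (Fin 3 → ZMod 2))) (x :: l) = if l = [] then 1 else 0 := by
  cases l <;> simp [K]

theorem dl_K {X : Type*} (ss : List ((X → ZMod 2) × (Fin 3 → ZMod 2))) : dl (K ss) = 0 := by
  induction ss with
  | nil =>
    have : K ([] : List ((X → ZMod 2) × (Fin 3 → ZMod 2))) =
        dl (fun l => if l = [] then 1 else 0) := by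
      funext l
      cases l with
      | nil => simp [K, dl]
      | cons x l => simp [dl, K_nil, dl_zero']
    rw [this]; funext l; exact dl_dl _ _
  | cons q ss ih =>
    rw [K_cons q ss ih]; funext l; exact dl_dl _ _

theorem K_inv {X : Type*} (Ω : Set X) (g : X → X) (k : Fin 3) 
    (ss : List ((X → ZMod 2) × (Fin 3 → ZMod 2)))
    (h : ∀ q ∈ ss, ∀ x ∈ Ω, q.1 (g x) = q.1 x + q.2 k) (l : List X) (hl : ∀ x ∈ l, x ∈ Ω) :
    K ss (l.map g) = K ss l := by
  induction ss generalizing l with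
  | nil =>
    match l with
    | [] => rfl
    | [x] => simp [K]
    | x :: y :: l => simp [K]
  | cons q ss ih =>
    match l with
    | [] => rfl
    | [x] => simp [K]
    | x :: y :: l =>
      have := ih (fun q hq => h q (by simp [hq])) (y :: l) (fun z hz => hl z (by
        simp only [List.mem_cons] at hz ⊢; tauto))
      simp only [List.map_cons] at this
      simp only [List.map_cons, K]
      rw [this, h q (by simp) x (hl x (by simp)), h q (by simp) y (hl y (by simp))]
      linear_combination (K ss (y :: l)) * two_self (q.2 k)

def coef : List (Fin 3 → ZMod 2) → (Fin 3 → ℤ) → ZMod 2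
  | [], n => if n = 0 then 1 else 0
  | χ :: r, n => ∑ k, χ k * coef r (n - Pi.single k 1)

theorem eval_K {X : Type*} (Ω : Set X) (T : Fin 3 → X → X) 
    (e : (Fin 3 → ℤ) → Fn X) (p0 : X) (nm : Fin 3 → ℤ)
    (hneg : ∀ n, (∃ k, n k < 0) → e n = 0)
    (h0 : ∀ c, e 0 c = c [p0])
    (hS : ∀ n ≤ nm, Supp (e n) (fun l => ∀ x ∈ l, x ∈ Ω))
    (hb : ∀ n ≤ nm, ∀ c, e n (dl c) =
      ∑ k, (e (n - Pi.single k 1) c + pull (T k) (e (n - Pi.single k 1)) c) + if n = 0 then c [] else 0)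
    (ss : List ((X → ZMod 2) × (Fin 3 → ZMod 2)))
    (hs : ∀ k, ∀ q ∈ ss, ∀ x ∈ Ω, q.1 (T k x) = q.1 x + q.2 k)
    (n : Fin 3 → ℤ) (hn : n ≤ nm) (hlen : ∑ k, n k = ss.length) :
    e n (K ss) = coef (ss.map Prod.snd) n := by
  induction ss generalizing n with
  | nil =>
    simp only [List.map_nil, coef]
    split_ifs with h
    · subst h; rw [h0]; rfl
    · have : ∃ k, n k < 0 := by
        by_contra hc
        push Not at hc
        apply h
        funext k
        exact (Finset.sum_eq_zero_iff_of_nonneg (fun k _ => hc k)).1 (by simpa using hlen) k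
          (Finset.mem_univ k)
      rw [hneg n this]; rfl
  | cons q ss ih =>
    rw [K_cons q ss (dl_K ss), hb n hn]
    simp only [List.map_cons, coef]
    have : (if n = 0 then cupS q.1 (K ss) [] else 0) = 0 := by simp [cupS]
    rw [this, add_zero]
    refine Finset.sum_congr rfl fun k _ => ?_
    have hn' : n - Pi.single k 1 ≤ nm := by
      refine le_trans ?_ hn
      intro j
      simp only [Pi.sub_apply, Pi.single_apply]
      split_ifs <;> simp
    rw [← ih (fun k q hq => hs k q (by simp [hq])) _ hn' (by
      simp only [Pi.sub_apply, Finset.sum_sub_distrib, hlen]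
      simp)]
    set e' := e (n - Pi.single k 1)
    have hq : q.2 k * e' (K ss) = e' (fun l => q.2 k * K ss l) := by
      rcases (show q.2 k = 0 ∨ q.2 k = 1 by generalize q.2 k = a; revert a; decide) with h | h
      · rw [h]; simp only [zero_mul]; exact e'.map_zero.symm
      · rw [h]; simp only [one_mul]
    rw [hq]
    change e' _ + e' _ = _
    rw [← e'.map_add]
    apply hS _ hn'
    intro l hl
    have hK := K_inv Ω (T k) k ss (fun q hq => hs k q (by simp [hq])) l hl
    cases l with
    | nil => cases ss <;> simp [cupS, K]
    | cons x l =>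
      simp only [Pi.add_apply, cupS, List.map_cons] at hK ⊢
      rw [hK, hs k q (by simp) x (hl x (by simp))]
      linear_combination two_self (q.1 x * K ss (x :: l))

/-! chains -/
abbrev V3 := Fin 3 → Fin 8 → ℝ

def Hs (i : ℤ) : Set (Fin 8 → ℝ) :=
  {v | (∀ m : Fin 8, i < (m : ℕ) → v m = 0) ∧ (∀ m : Fin 8, i = (m : ℕ) → 0 ≤ v m) ∧ ∑ m, |v m| = 1}

def Dn (n : Fin 3 → ℤ) : Set V3 := {x | ∀ k, x k ∈ Hs (n k)}

def Tk (k : Fin 3) (x : V3) : V3 := fun j => if j = k then - x j else x j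

def p0 : V3 := fun _ => Pi.single 0 1

theorem Hs_abs {i : ℤ} {v : Fin 8 → ℝ} (h : v ∈ Hs i) (m : Fin 8) : |v m| ≤ 1 := by
  rw [← h.2.2]
  exact Finset.single_le_sum (f := fun m => |v m|) (fun _ _ => abs_nonneg _) (Finset.mem_univ m)

theorem Hs_star (i : ℕ) (hi : i < 8) (v : Fin 8 → ℝ) (hv : v ∈ Hs i) (t : ℝ) (h0 : 0 ≤ t)
    (h1 : t ≤ 1) : v + t • (Pi.single (⟨i, hi⟩ : Fin 8) (1 : ℝ) - v) ∈ Hs i := by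
  obtain ⟨a, b, c⟩ := hv
  have hval : ∀ m : Fin 8, (v + t • ((Pi.single (⟨i, hi⟩ : Fin 8) (1 : ℝ) : Fin 8 → ℝ) - v) : Fin 8 → ℝ) m =
      (1 - t) * v m + t * (if m = ⟨i, hi⟩ then 1 else 0) := by
    intro m
    simp only [Pi.add_apply, Pi.smul_apply, Pi.sub_apply, Pi.single_apply, smul_eq_mul]
    ring
  have hvi : 0 ≤ v ⟨i, hi⟩ := b ⟨i, hi⟩ rfl
  refine ⟨?_, ?_, ?_⟩
  · intro m hm
    rw [hval, a m hm, if_neg]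
    · simp
    · rintro rfl; simp at hm
  · intro m hm
    rw [hval]
    have := b m hm
    have h3 : 0 ≤ 1 - t := by linarith
    split_ifs <;> positivity
  · have : ∀ m : Fin 8, |(v + t • ((Pi.single (⟨i, hi⟩ : Fin 8) (1 : ℝ) : Fin 8 → ℝ) - v) : Fin 8 → ℝ) m| =
      (1 - t) * |v m| + t * (if m = ⟨i, hi⟩ then 1 else 0) := by
      intro m
      rw [hval]
      have h3 : 0 ≤ 1 - t := by linarith
      split_ifs with h
      · subst h
        rw [abs_of_nonneg hvi, abs_of_nonneg]
        positivity
      · simp [abs_mul, abs_of_nonneg h3]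
    simp only [this, Finset.sum_add_distrib, ← Finset.mul_sum, c]
    simp

theorem Hs_pole (i : ℕ) (hi : i < 8) : Pi.single (⟨i, hi⟩ : Fin 8) (1 : ℝ) ∈ Hs i := by
  refine ⟨?_, ?_, ?_⟩
  · intro m hm
    rw [Pi.single_apply, if_neg]
    rintro rfl; simp at hm
  · intro m hm
    rw [Pi.single_apply]; split_ifs <;> simp
  · rw [Finset.sum_eq_single (⟨i, hi⟩ : Fin 8)]
    · simp
    · intro b _ hb; simp [hb]
    · simp

theorem Hs_sub (i : ℤ) : Hs (i - 1) ⊆ Hs i := by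
  rintro v ⟨a, b, c⟩
  refine ⟨fun m hm => a m (by omega), fun m hm => (a m (by omega)).ge, c⟩

theorem Hs_neg (i : ℤ) (v) (hv : v ∈ Hs (i - 1)) : -v ∈ Hs i := by
  obtain ⟨a, b, c⟩ := hv
  refine ⟨fun m hm => by simp [a m (by omega)], fun m hm => by simp [a m (by omega)], by simpa using c⟩

theorem Dn_sub (n : Fin 3 → ℤ) (k : Fin 3) (x) (hx : x ∈ Dn (n - Pi.single k 1)) : x ∈ Dn n := by
  intro j
  have := hx j
  simp only [Pi.sub_apply, Pi.single_apply] at this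
  split_ifs at this with h
  · exact Hs_sub _ this
  · simpa using this

theorem Dn_T (n : Fin 3 → ℤ) (k : Fin 3) (x) (hx : x ∈ Dn (n - Pi.single k 1)) :
    Tk k x ∈ Dn n := by
  intro j
  have := hx j
  simp only [Pi.sub_apply, Pi.single_apply] at this
  unfold Tk
  split_ifs at this ⊢ with h
  · exact Hs_neg _ _ this
  · simpa using this

theorem Tk_norm (k : Fin 3) (x y : V3) : ‖Tk k x - Tk k y‖ ≤ ‖x - y‖ := by
  rw [pi_norm_le_iff_of_nonneg (norm_nonneg _)]
  intro j
  have h := norm_le_pi_norm (x - y) j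
  simp only [Pi.sub_apply, Tk] at h ⊢
  split_ifs
  · rw [← norm_neg]; convert h using 2; abel
  · exact h

theorem Tk_Tk (k : Fin 3) (x : V3) : Tk k (Tk k x) = x := by
  funext j; simp only [Tk]; split_ifs <;> simp

theorem Tk_comm (k i : Fin 3) (x : V3) : Tk k (Tk i x) = Tk i (Tk k x) := by
  funext j; simp only [Tk]; split_ifs <;> simp

theorem sum_symm (a : Fin 3 → Fin 3 → ZMod 2) (h : ∀ i j, a i j = a j i) (h0 : ∀ i, a i i = 0) :
    ∑ i, ∑ j, a i j = 0 := by
  simp only [Fin.sum_univ_three, h0]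
  rw [h 1 0, h 2 0, h 2 1]
  linear_combination two_self (a 0 1) + two_self (a 0 2) + two_self (a 1 2)

theorem sml_mono {n : Fin 3 → ℤ} {ε ε' : ℝ} (h : ε ≤ ε') {l} (hl : sml (Dn n) ε l) :
    sml (Dn n) ε' l := ⟨hl.1, fun x hx y hy => (hl.2 x hx y hy).trans h⟩

theorem sum_single_sub (n : Fin 3 → ℤ) (k : Fin 3) :
    ∑ j, (n - (Pi.single k 1 : Fin 3 → ℤ) : Fin 3 → ℤ) j = ∑ j, n j - 1 := by
  simp only [Pi.sub_apply, Finset.sum_sub_distrib]; simp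

def bd (e : (Fin 3 → ℤ) → Fn V3) (n : Fin 3 → ℤ) : Fn V3 :=
  ∑ k, (e (n - Pi.single k 1) + pull (Tk k) (e (n - Pi.single k 1)))

theorem bd_apply (e : (Fin 3 → ℤ) → Fn V3) (n : Fin 3 → ℤ) (c) : bd e n c = 
    ∑ k, (e (n - Pi.single k 1) c + pull (Tk k) (e (n - Pi.single k 1)) c) := by
  simp [bd, AddMonoidHom.finsetSum_apply]

theorem bd_cycle (e : (Fin 3 → ℤ) → Fn V3) (n : Fin 3 → ℤ)
    (hb : ∀ k c, e (n - Pi.single k 1) (dl c) = bd e (n - Pi.single k 1) c +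
      if n - Pi.single k 1 = 0 then c [] else 0) (c) : bd e n (dl c) = 0 := by
  rw [bd_apply]
  let a : Fin 3 → Fin 3 → ZMod 2 := fun k j =>
    let e' := e (n - Pi.single k 1 - Pi.single j 1)
    e' c + e' (fun l => c (l.map (Tk j))) + (e' (fun l => c (l.map (Tk k))) +
      e' (fun l => c ((l.map (Tk j)).map (Tk k))))
  have key : ∀ k, e (n - Pi.single k 1) (dl c) + pull (Tk k) (e (n - Pi.single k 1)) (dl c) =
      ∑ j, a k j := by
    intro k
    have h2 : pull (Tk k) (e (n - Pi.single k 1)) (dl c) =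
       e (n - Pi.single k 1) (dl (fun l => c (l.map (Tk k)))) := by
      change e (n - Pi.single k 1) _ = _
      congr 1; funext l; rw [dl_map]
    rw [h2, hb, hb, bd_apply, bd_apply]
    simp only [a, Finset.sum_add_distrib]
    simp only [pull, AddMonoidHom.coe_mk, ZeroHom.coe_mk, List.map_nil]
    linear_combination two_self (if n - Pi.single k 1 = 0 then c [] else 0)
  simp only [key]
  apply sum_symm
  · intro i j
    simp only [a]
    rw [sub_right_comm n (Pi.single j 1)]
    have : (fun l : List V3 => c ((l.map (Tk j)).map (Tk i))) =
      (fun l => c ((l.map (Tk i)).map (Tk j))) := by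
      funext l
      congr 1
      simp only [List.map_map]
      congr 1
      funext x
      exact Tk_comm _ _ _
    rw [this]; ring
  · intro i
    simp only [a]
    have : (fun l : List V3 => c ((l.map (Tk i)).map (Tk i))) = c := by
      funext l
      congr 1
      simp only [List.map_map]
      convert List.map_id l
      funext x
      exact Tk_Tk _ _
    rw [this]
    set e' := e (n - Pi.single i 1 - Pi.single i 1)
    linear_combination two_self (e' c) + two_self (e' (fun l => c (l.map (Tk i))))

theorem fill_step (e : (Fin 3 → ℤ) → Fn V3) (n : Fin 3 → ℤ) (ε : ℝ) (hε : 0 < ε)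
    (h0 : ∀ k, 0 ≤ n k) (h7 : ∀ k, n k ≤ 7)
    (hS : ∀ k, Supp (e (n - Pi.single k 1)) (sml (Dn (n - Pi.single k 1)) (ε / 2)))
    (hb : ∀ k c, e (n - Pi.single k 1) (dl c) = bd e (n - Pi.single k 1) c +
      if n - Pi.single k 1 = 0 then c [] else 0) :
    ∃ M : Fn V3, Supp M (sml (Dn n) ε) ∧ ∀ c, M (dl c) = bd e n c := by
  have hn : ∀ k, ∃ i : ℕ, i < 8 ∧ n k = i := fun k => ⟨(n k).toNat, by
    have := h0 k; have := h7 k; omega, by have := h0 k; omega⟩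
  choose i hi hni using hn
  refine fill (Dn n) (fun k => Pi.single (⟨i k, hi k⟩ : Fin 8) (1 : ℝ)) ?_ ?_ 2 ?_ (ε / 2) ε
    (by linarith) (by linarith) (bd e n) (bd_cycle e n hb) ?_
  · intro k; rw [hni]; exact Hs_pole _ _
  · intro x hx t ht0 ht1 k
    have := hx k
    rw [hni] at this ⊢
    exact Hs_star _ _ _ this t ht0 ht1
  · intro x hx
    rw [pi_norm_le_iff_of_nonneg (by norm_num)]
    intro k
    rw [pi_norm_le_iff_of_nonneg (by norm_num)]
    intro m
    have h1 := Hs_abs (hx k) m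
    have h2 := Hs_abs (Hs_pole (i k) (hi k)) m
    simp only [Pi.sub_apply, Real.norm_eq_abs]
    exact (abs_sub _ _).trans (by linarith)
  · intro c c' h
    rw [bd_apply, bd_apply]
    refine Finset.sum_congr rfl fun k _ => ?_
    congr 1
    · apply hS
      intro l hl
      exact h l ⟨fun x hx => Dn_sub n k x (hl.1 x hx), hl.2⟩
    · apply hS k
      intro l hl
      apply h
      constructor
      · intro x hx
        obtain ⟨y, hy, rfl⟩ := List.mem_map.1 hx
        exact Dn_T n k y (hl.1 y hy)
      · intro x hx x' hx'
        obtain ⟨y, hy, rfl⟩ := List.mem_map.1 hx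
        obtain ⟨y', hy', rfl⟩ := List.mem_map.1 hx'
        exact (Tk_norm _ _ _).trans (hl.2 y hy y' hy')

theorem chains (N : ℕ) : ∀ ε : ℝ, 0 < ε → ∃ e : (Fin 3 → ℤ) → Fn V3,
    (∀ n, (∃ k, n k < 0) → e n = 0) ∧ (∀ c, e 0 c = c [p0]) ∧
    ∀ n : Fin 3 → ℤ, (∀ k, n k ≤ 7) → ∑ k, n k ≤ N → Supp (e n) (sml (Dn n) ε) ∧
      ∀ c, e n (dl c) = bd e n c + if n = 0 then c [] else 0 := by
  induction N with
  | zero =>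
    intro ε hε
    let ev : Fn V3 := { toFun := fun c => c [p0], map_zero' := rfl, map_add' := fun _ _ => rfl }
    refine ⟨fun n => if n = 0 then ev else 0, ?_, ?_, ?_⟩
    · rintro n ⟨k, hk⟩
      change (if n = 0 then ev else 0) = 0
      rw [if_neg]; rintro rfl; simp at hk
    · intro c; simp [ev]
    · intro n h7 hn
      have hz : ∀ k, n - Pi.single k 1 ≠ 0 := by
        intro k h
        have := sum_single_sub n k
        rw [h] at this
        simp at this hn
        omega
      have hbd : bd (fun n => if n = 0 then ev else 0) n = 0 := by
        ext c
        rw [bd_apply]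
        simp [hz, pull]
      rw [hbd]
      by_cases h : n = 0
      · subst h
        constructor
        · intro c c' hc
          simp only [if_true]
          apply hc
          constructor
          · intro x hx
            simp only [List.mem_singleton] at hx
            subst hx
            intro k
            exact Hs_pole 0 (by norm_num)
          · intro x hx y hy
            simp only [List.mem_singleton] at hx hy
            subst hx; subst hy; simpa using hε.le
        · intro c; simp [ev, dl]
      · simp [h, Supp]
  | succ N ih =>
    intro ε hε
    obtain ⟨e, hneg, h0, he⟩ := ih (ε / 2) (by linarith)
    have hx : ∀ n : Fin 3 → ℤ, (∑ k, n k = N + 1 ∧ (∀ k, 0 ≤ n k) ∧ ∀ k, n k ≤ 7) →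
        ∃ M : Fn V3, Supp M (sml (Dn n) ε) ∧ ∀ c, M (dl c) = bd e n c := by
      rintro n ⟨hs, hn0, hn7⟩
      have h' : ∀ k, _ := fun k => he (n - Pi.single k 1) (fun j => by
        have := hn7 j
        simp only [Pi.sub_apply, Pi.single_apply]; split_ifs <;> omega) (by
        rw [sum_single_sub]; omega)
      exact fill_step e n ε hε hn0 hn7 (fun k => (h' k).1) (fun k => (h' k).2)
    choose! M hM1 hM2 using hx
    classical
    let e' : (Fin 3 → ℤ) → Fn V3 := fun n =>
      if (∑ k, n k = N + 1 ∧ (∀ k, 0 ≤ n k) ∧ ∀ k, n k ≤ 7) then M n else e n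
    have hlow : ∀ n : Fin 3 → ℤ, ∑ k, n k ≤ N → e' n = e n := by
      intro n hn
      simp only [e']; rw [if_neg]; rintro ⟨h, _⟩; omega
    have hbd : ∀ n : Fin 3 → ℤ, ∑ k, n k ≤ N + 1 → bd e' n = bd e n := by
      intro n hn
      unfold bd
      refine Finset.sum_congr rfl fun k _ => ?_
      rw [hlow]
      rw [sum_single_sub]; omega
    have hneg' : ∀ n, (∃ k, n k < 0) → e' n = 0 := by
      rintro n ⟨k, hk⟩
      simp only [e']; rw [if_neg]
      · exact hneg n ⟨k, hk⟩
      · rintro ⟨_, h, _⟩; have := h k; omega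
    refine ⟨e', hneg', ?_, ?_⟩
    · intro c; rw [hlow 0 (by simp), h0]
    · intro n h7 hn
      push_cast at hn
      rw [hbd n hn]
      by_cases hN : ∑ k, n k ≤ N
      · rw [hlow n hN]
        obtain ⟨a, b⟩ := he n h7 hN
        refine ⟨fun c c' h => a c c' fun l hl => h l (sml_mono (by linarith) hl), b⟩
      · have hN1 : ∑ k, n k = N + 1 := by omega
        have hn0 : n ≠ 0 := by rintro rfl; simp at hN1; omega
        simp only [if_neg hn0]
        by_cases hp : ∀ k, 0 ≤ n k
        · have : e' n = M n := by simp only [e']; rw [if_pos ⟨hN1, hp, h7⟩]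
          rw [this]
          exact ⟨hM1 n ⟨hN1, hp, h7⟩, by simpa using hM2 n ⟨hN1, hp, h7⟩⟩
        · push Not at hp
          obtain ⟨k, hk⟩ := hp
          rw [hneg' n ⟨k, hk⟩]
          have : bd e n = 0 := by
            unfold bd
            apply Finset.sum_eq_zero
            intro j _
            rw [hneg (n - Pi.single j 1) ⟨k, by
              simp only [Pi.sub_apply, Pi.single_apply]; split_ifs <;> omega⟩]
            ext c; simp [pull]
          rw [this]
          exact ⟨fun _ _ _ => rfl, fun c => by simp⟩

theorem coef_neg (r : List (Fin 3 → ZMod 2)) (n : Fin 3 → ℤ) (h : ∃ k, n k < 0) :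
    coef r n = 0 := by
  obtain ⟨k, hk⟩ := h
  induction r generalizing n with
  | nil =>
    simp only [coef]; rw [if_neg]; rintro rfl; simp at hk
  | cons χ r ih =>
    simp only [coef]
    apply Finset.sum_eq_zero
    intro j _
    rw [ih, mul_zero]
    simp only [Pi.sub_apply, Pi.single_apply]; split_ifs <;> omega

def bz (b : Bool) : ZMod 2 := if b then 1 else 0

theorem bz_xor (a b : Bool) : bz (xor a b) = bz a + bz b := by revert a b; decide

theorem bz_and (a b : Bool) : bz (a && b) = bz a * bz b := by revert a b; decide

def cB : List (Bool × Bool × Bool) → ℕ → ℕ → ℕ → Bool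
  | [], i, j, k => i == 0 && (j == 0 && k == 0)
  | χ :: r, i, j, k => xor (xor (χ.1 && (match i with | 0 => false | i + 1 => cB r i j k))
      (χ.2.1 && (match j with | 0 => false | j + 1 => cB r i j k)))
      (χ.2.2 && (match k with | 0 => false | k + 1 => cB r i j k))

theorem coef_cB (r : List (Bool × Bool × Bool)) (i j k : ℕ) :
    coef (r.map fun χ => ![bz χ.1, bz χ.2.1, bz χ.2.2]) ![(i : ℤ), j, k] = bz (cB r i j k) := by
  induction r generalizing i j k with
  | nil =>
    simp only [List.map_nil, coef, cB, bz]
    congr 1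
    simp [funext_iff, Fin.forall_fin_succ]
  | cons χ r ih =>
    simp only [List.map_cons, coef, Fin.sum_univ_three, cB, bz_xor, bz_and]
    have e0 : (![(i : ℤ), j, k] - Pi.single 0 1 : Fin 3 → ℤ) = ![(i : ℤ) - 1, j, k] := by
      funext m; fin_cases m <;> simp
    have e1 : (![(i : ℤ), j, k] - Pi.single 1 1 : Fin 3 → ℤ) = ![(i : ℤ), j - 1, k] := by
      funext m; fin_cases m <;> simp
    have e2 : (![(i : ℤ), j, k] - Pi.single 2 1 : Fin 3 → ℤ) = ![(i : ℤ), j, k - 1] := by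
      funext m; fin_cases m <;> simp
    rw [e0, e1, e2]
    congr 1
    · congr 1
      · congr 1
        cases i with
        | zero => rw [coef_neg _ _ ⟨0, by simp⟩]; rfl
        | succ i => simp only [Nat.cast_add, Nat.cast_one, add_sub_cancel_right]; exact ih i j k
      · congr 1
        cases j with
        | zero => rw [coef_neg _ _ ⟨1, by simp⟩]; rfl
        | succ j => simp only [Nat.cast_add, Nat.cast_one, add_sub_cancel_right]; exact ih i j k
    · congr 1
      cases k with
      | zero => rw [coef_neg _ _ ⟨2, by simp⟩]; rfl
      | succ k => simp only [Nat.cast_add, Nat.cast_one, add_sub_cancel_right]; exact ih i j k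

def chiL : List (Bool × Bool × Bool) :=
  let x := (false, true, false)
  let xa := (true, true, false)
  let y := (false, false, true)
  let ya := (true, false, true)
  let xy := (false, true, true)
  let xya := (true, true, true)
  [x, x, x, xa, xa, y, y, y, ya, ya, xy, xy, xy, xya, xya]

theorem cB_val : cB chiL 6 6 3 = true := by
  decide +kernel


theorem K_zero {X : Type*} (ss : List ((X → ZMod 2) × (Fin 3 → ZMod 2))) (q) (hq : q ∈ ss)
    (l : List X) (h : ∀ x ∈ l, ∀ y ∈ l, q.1 x = q.1 y) : K ss l = 0 := by
  induction ss generalizing l with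
  | nil => simp at hq
  | cons q' ss ih =>
    match l with
    | [] => simp [K]
    | [x] => simp [K]
    | x :: y :: l =>
      simp only [K]
      rcases List.mem_cons.1 hq with rfl | hq
      · rw [h x (by simp) y (by simp), two_self, zero_mul]
      · rw [ih hq (y :: l) (fun a ha b hb => h a (List.mem_cons_of_mem _ ha) b
          (List.mem_cons_of_mem _ hb)), mul_zero]

def lexP (v : Fin 8 → ℝ) : Prop := ∃ m, 0 < v m ∧ ∀ j < m, v j = 0

open Classical in
noncomputable def sig (v : Fin 8 → ℝ) : ZMod 2 := if lexP v then 0 else 1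

theorem lexP_not (v : Fin 8 → ℝ) (h : lexP v) : ¬ lexP (-v) := by
  obtain ⟨m, hm, hj⟩ := h
  rintro ⟨m', hm', hj'⟩
  simp only [Pi.neg_apply] at hm' hj'
  rcases lt_trichotomy m m' with h | h | h
  · have := hj' m h; linarith
  · subst h; linarith
  · have := hj m' h; linarith

theorem lexP_or (v : Fin 8 → ℝ) (h : v ≠ 0) : lexP v ∨ lexP (-v) := by
  have hne : ∃ m, v m ≠ 0 := by
    by_contra hc; push Not at hc; exact h (funext hc)
  obtain ⟨m, hm, hmin⟩ := WellFounded.has_min (wellFounded_lt (α := Fin 8)) {m | v m ≠ 0} hne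
  have hz : ∀ j < m, v j = 0 := by
    intro j hj; by_contra hc; exact hmin j hc hj
  rcases lt_or_gt_of_ne hm with h1 | h1
  · right; exact ⟨m, by simpa using h1, fun j hj => by simp [hz j hj]⟩
  · left; exact ⟨m, h1, hz⟩

theorem sig_neg (v : Fin 8 → ℝ) (h : v ≠ 0) : sig (-v) = sig v + 1 := by
  unfold sig
  rcases lexP_or v h with h1 | h1
  · rw [if_pos h1, if_neg (lexP_not v h1)]; decide
  · have := lexP_not (-v) h1
    rw [neg_neg] at this
    rw [if_pos h1, if_neg this]; decide

def chiF (χ : Bool × Bool × Bool) : Fin 3 → ZMod 2 := ![bz χ.1, bz χ.2.1, bz χ.2.2]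
def chiB (χ : Bool × Bool × Bool) : Fin 3 → Bool := ![χ.1, χ.2.1, χ.2.2]

theorem chiF_eq (χ) (k) : chiF χ k = bz (chiB χ k) := by
  fin_cases k <;> rfl

noncomputable def sg2 (F : V3 → ℝ) (χ : Bool × Bool × Bool) (x : V3) : ZMod 2 :=
  if 0 < F x then 0 else if F x < 0 then 1 else ∑ k, chiF χ k * sig (x k)

theorem sg2_equiv (F : V3 → ℝ) (χ : Bool × Bool × Bool) (x : V3) (k : Fin 3)
    (hx : x k ≠ 0) (hF : F (Tk k x) = (if chiB χ k then -1 else 1) * F x) :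
    sg2 F χ (Tk k x) = sg2 F χ x + chiF χ k := by
  unfold sg2
  rw [hF]
  have hsum : ∑ j, chiF χ j * sig (Tk k x j) = ∑ j, chiF χ j * sig (x j) + chiF χ k := by
    have : ∀ j, chiF χ j * sig (Tk k x j) = chiF χ j * sig (x j) + if j = k then chiF χ j else 0 := by
      intro j
      unfold Tk
      split_ifs with h
      · subst h; rw [sig_neg _ hx]; ring
      · simp
    simp only [this, Finset.sum_add_distrib]
    simp
  rw [hsum, chiF_eq]
  cases chiB χ k
  · simp [bz]
  · rcases lt_trichotomy (F x) 0 with h | h | h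
    · simp [bz, h, h.not_gt]; decide
    · simp [bz, h]
    · simp [bz, h, h.not_gt]

theorem Dn_compact : IsCompact (Dn ![6, 6, 3]) := by
  have hcl : IsClosed (Dn ![6, 6, 3]) := by
    have hH : ∀ i, IsClosed (Hs i) := by
      intro i
      unfold Hs
      have : {v : Fin 8 → ℝ | (∀ m : Fin 8, i < (m : ℕ) → v m = 0) ∧
        (∀ m : Fin 8, i = (m : ℕ) → 0 ≤ v m) ∧ ∑ m, |v m| = 1} =
        (⋂ m : Fin 8, ⋂ _ : i < (m : ℕ), {v | v m = 0}) ∩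
        ((⋂ m : Fin 8, ⋂ _ : i = (m : ℕ), {v | 0 ≤ v m}) ∩ {v | ∑ m, |v m| = 1}) := by
        ext v; simp
      rw [this]
      refine IsClosed.inter ?_ (IsClosed.inter ?_ ?_)
      · exact isClosed_iInter fun m => isClosed_iInter fun _ =>
          isClosed_eq (continuous_apply m) continuous_const
      · exact isClosed_iInter fun m => isClosed_iInter fun _ =>
          isClosed_le continuous_const (continuous_apply m)
      · exact isClosed_eq (by fun_prop) continuous_const
    have : Dn ![6, 6, 3] = ⋂ k, (fun x : V3 => x k) ⁻¹' (Hs ((![6, 6, 3] : Fin 3 → ℤ) k)) := by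
      ext x; simp [Dn]
    rw [this]
    exact isClosed_iInter fun k => (hH _).preimage (continuous_apply k)
  refine Metric.isCompact_of_isClosed_isBounded hcl ?_
  rw [isBounded_iff_forall_norm_le]
  refine ⟨1, fun x hx => ?_⟩
  rw [pi_norm_le_iff_of_nonneg (by norm_num)]
  intro k
  rw [pi_norm_le_iff_of_nonneg (by norm_num)]
  intro m
  exact Hs_abs (hx k) m

theorem small_sep (Fl : List ((V3 → ℝ) × (Bool × Bool × Bool)))
    (hc : ∀ q ∈ Fl, ContinuousOn q.1 (Dn ![6, 6, 3]))
    (hnz : ¬ ∃ x ∈ Dn ![6, 6, 3], ∀ q ∈ Fl, q.1 x = 0) :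
    ∃ δ > 0, ∀ x ∈ Dn ![6, 6, 3], ∃ q ∈ Fl, ∀ y ∈ Dn ![6, 6, 3], ‖x - y‖ ≤ δ →
      0 < q.1 x * q.1 y := by
  by_contra hcon
  push Not at hcon
  have hcon' := fun n : ℕ => hcon (1 / ((n : ℝ) + 1)) (by positivity)
  choose x hxD hx using hcon'
  obtain ⟨z, hz, φ, hφ, hlim⟩ := Dn_compact.tendsto_subseq hxD
  apply hnz
  refine ⟨z, hz, fun q hq => ?_⟩
  have h2 := fun n => hx n q hq
  choose y hyD hxy hle using h2
  have hylim : Filter.Tendsto (y ∘ φ) Filter.atTop (nhds z) := by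
    rw [tendsto_iff_norm_sub_tendsto_zero] at hlim ⊢
    have h0 : Filter.Tendsto (fun n => 1 / ((φ n : ℝ) + 1) + ‖(x ∘ φ) n - z‖) Filter.atTop (nhds 0) := by
      simpa using (tendsto_one_div_add_atTop_nhds_zero_nat.comp hφ.tendsto_atTop).add hlim
    refine squeeze_zero (fun _ => norm_nonneg _) (fun n => ?_) h0
    have h1 := norm_sub_le_norm_sub_add_norm_sub (y (φ n)) (x (φ n)) z
    rw [norm_sub_rev (y (φ n)) (x (φ n))] at h1
    have h2 := hxy (φ n)
    simp only [Function.comp_apply]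
    linarith
  have hw : ∀ s : ℕ → V3, (∀ n, s n ∈ Dn ![6, 6, 3]) → Filter.Tendsto s Filter.atTop (nhds z) →
      Filter.Tendsto (fun n => q.1 (s n)) Filter.atTop (nhds (q.1 z)) := by
    intro s hs hl
    exact (hc q hq z hz).tendsto.comp
      (tendsto_nhdsWithin_iff.2 ⟨hl, Filter.Eventually.of_forall hs⟩)
  have l1 := hw _ (fun n => hxD (φ n)) hlim
  have l2 := hw _ (fun n => hyD (φ n)) hylim
  have := le_of_tendsto (l1.mul l2) (Filter.Eventually.of_forall fun n => hle (φ n))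
  nlinarith [mul_self_nonneg (q.1 z), mul_self_eq_zero.1 (le_antisymm this (mul_self_nonneg (q.1 z)))]

theorem zero_exists (Ω : Set V3) (hΩ : ∀ x ∈ Ω, ∀ k, x k ≠ 0)
    (hD : ∀ n : Fin 3 → ℤ, n ≤ ![6, 6, 3] → Dn n ⊆ Ω)
    (Fl : List ((V3 → ℝ) × (Bool × Bool × Bool)))
    (hlen : Fl.length = 15) (hval : cB (Fl.map Prod.snd) 6 6 3 = true)
    (hc : ∀ q ∈ Fl, ContinuousOn q.1 (Dn ![6, 6, 3]))
    (hF : ∀ q ∈ Fl, ∀ x ∈ Ω, ∀ k, q.1 (Tk k x) = (if chiB q.2 k then -1 else 1) * q.1 x) :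
    ∃ x ∈ Dn ![6, 6, 3], ∀ q ∈ Fl, q.1 x = 0 := by
  by_contra hnz
  obtain ⟨δ, hδ, hsep⟩ := small_sep Fl hc hnz
  obtain ⟨e, hneg, h0, he⟩ := chains 15 δ hδ
  set ss : List ((V3 → ZMod 2) × (Fin 3 → ZMod 2)) :=
    Fl.map (fun q => (sg2 q.1 q.2, chiF q.2)) with hss
  have h7 : ∀ n : Fin 3 → ℤ, n ≤ ![6, 6, 3] → (∀ k, n k ≤ 7) ∧ ∑ k, n k ≤ (15 : ℕ) := by
    intro n hn
    have a0 := hn 0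
    have a1 := hn 1
    have a2 := hn 2
    simp at a0 a1 a2
    constructor
    · intro k; fin_cases k <;> simp <;> omega
    · rw [Fin.sum_univ_three]; push_cast; omega
  have h1 : e ![6, 6, 3] (K ss) = coef (ss.map Prod.snd) ![6, 6, 3] := by
    apply eval_K Ω Tk e p0 ![6, 6, 3] hneg h0
    · intro n hn c c' h
      apply (he n (h7 n hn).1 (h7 n hn).2).1
      intro l hl
      exact h l fun x hx => hD n hn (hl.1 x hx)
    · intro n hn c
      rw [(he n (h7 n hn).1 (h7 n hn).2).2, bd_apply]
    · intro k q hq x hx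
      obtain ⟨q', hq', rfl⟩ := List.mem_map.1 hq
      exact sg2_equiv _ _ _ _ (hΩ x hx k) (hF q' hq' x hx k)
    · rfl
    · simp [hss, hlen, Fin.sum_univ_three]
  have h2 : coef (ss.map Prod.snd) ![6, 6, 3] = 1 := by
    have := coef_cB (Fl.map Prod.snd) 6 6 3
    rw [hval] at this
    have hl : ss.map Prod.snd = (Fl.map Prod.snd).map fun χ => ![bz χ.1, bz χ.2.1, bz χ.2.2] := by
      rw [hss, List.map_map, List.map_map]; rfl
    rw [hl]
    exact this
  have h3 : e ![6, 6, 3] (K ss) = e ![6, 6, 3] 0 := by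
    apply (he _ (h7 _ le_rfl).1 (h7 _ le_rfl).2).1
    intro l hl
    cases l with
    | nil =>
      cases ss <;> simp [K]
    | cons x l =>
      obtain ⟨q, hq, hqs⟩ := hsep x (hl.1 x (by simp))
      apply K_zero ss (sg2 q.1 q.2, chiF q.2) (List.mem_map.2 ⟨q, hq, rfl⟩)
      have : ∀ y ∈ x :: l, sg2 q.1 q.2 y = if 0 < q.1 x then 0 else 1 := by
        intro y hy
        have hp := hqs y (hl.1 y hy) (hl.2 x (by simp) y hy)
        unfold sg2
        rcases pos_and_pos_or_neg_and_neg_of_mul_pos hp with ⟨a, b⟩ | ⟨a, b⟩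
        · rw [if_pos a, if_pos b]
        · rw [if_neg a.not_gt, if_neg b.not_gt, if_pos b]
      intro y hy y' hy'
      exact (this y hy).trans (this y' hy').symm
  rw [h1, h2, map_zero] at h3
  exact one_ne_zero h3


open MeasureTheory Filter Topology

abbrev E7 := EuclideanSpace ℝ (Fin 7)

noncomputable def th (r : ℝ) : ℝ := if 0 < r then 1 else 0

theorem th_meas : Measurable th := Measurable.ite measurableSet_Ioi measurable_const measurable_const

theorem th_nonneg (r : ℝ) : 0 ≤ th r := by unfold th; split_ifs <;> norm_num
theorem th_le (r : ℝ) : th r ≤ 1 := by unfold th; split_ifs <;> norm_num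
theorem th_pos {r : ℝ} (h : 0 < r) : th r = 1 := if_pos h
theorem th_neg {r : ℝ} (h : r ≤ 0) : th r = 0 := if_neg h.not_gt

theorem th_flip {r : ℝ} (h : r ≠ 0) : th (-r) = 1 - th r := by
  rcases lt_or_gt_of_ne h with h | h
  · rw [th_pos (by linarith), th_neg h.le]; simp
  · rw [th_neg (by linarith), th_pos h]; simp

theorem th_cont {r : ℝ} (h : r ≠ 0) : ContinuousAt th r := by
  rcases lt_or_gt_of_ne h with h | h
  · have : th =ᶠ[𝓝 r] fun _ => 0 := by
      filter_upwards [Iio_mem_nhds h] with x hx using th_neg (le_of_lt hx)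
    exact continuousAt_const.congr this.symm
  · have : th =ᶠ[𝓝 r] fun _ => 1 := by
      filter_upwards [Ioi_mem_nhds h] with x hx using th_pos hx
    exact continuousAt_const.congr this.symm

theorem hyp_null (μ : Measure E7) (hac : μ ≪ volume) (u : E7) (t : ℝ) (h : u ≠ 0 ∨ t ≠ 0) :
    ∀ᵐ y ∂μ, (inner ℝ y u : ℝ) - t ≠ 0 := by
  by_cases hu : u = 0
  · subst hu
    have ht : t ≠ 0 := by simpa using h
    exact Eventually.of_forall fun y => by simpa using ht
  · have hv : ∀ᵐ y ∂(volume : Measure E7), (inner ℝ y u : ℝ) - t ≠ 0 := by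
      rw [ae_iff]
      simp only [ne_eq, not_not]
      have huu : (inner ℝ u u : ℝ) ≠ 0 := inner_self_ne_zero.2 hu
      have hker : LinearMap.ker (innerSL ℝ u).toLinearMap ≠ ⊤ := by
        intro h0
        have : u ∈ LinearMap.ker (innerSL ℝ u).toLinearMap := by rw [h0]; trivial
        exact huu (by simpa using this)
      have h1 := Measure.addHaar_submodule (volume : Measure E7) _ hker
      rw [← measure_preimage_add_right volume (-((t / (inner ℝ u u : ℝ)) • u))] at h1
      refine measure_mono_null ?_ h1
      intro y hy
      have hy' : (inner ℝ y u : ℝ) - t = 0 := hy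
      have : (inner ℝ u (y + -((t / (inner ℝ u u : ℝ)) • u)) : ℝ) = 0 := by
        rw [inner_add_right, inner_neg_right, inner_smul_right, div_mul_cancel₀ _ huu,
          real_inner_comm]
        linarith
      simpa using this
    exact hac.ae_le hv

theorem cont_int {P : Type*} [TopologicalSpace P] [FirstCountableTopology P] (μ : Measure E7)
    [IsFiniteMeasure μ] (Φ : P → E7 → ℝ) (s : Set P) (p : P)
    (hm : ∀ p, Measurable (Φ p)) (hb : ∀ p y, |Φ p y| ≤ 1)
    (hc : ∀ᵐ y ∂μ, ContinuousWithinAt (fun p => Φ p y) s p) :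
    ContinuousWithinAt (fun p => ∫ y, Φ p y ∂μ) s p := by
  apply continuousWithinAt_of_dominated (bound := fun _ => 1)
  · exact Eventually.of_forall fun p => (hm p).aestronglyMeasurable
  · exact Eventually.of_forall fun p => Eventually.of_forall fun y => hb p y
  · exact integrable_const _
  · exact hc

theorem int_bdd (μ : Measure E7) [IsFiniteMeasure μ] (f : E7 → ℝ) (hm : Measurable f)
    (C : ℝ) (hb : ∀ y, |f y| ≤ C) : Integrable f μ :=
  Integrable.of_bound hm.aestronglyMeasurable C (Eventually.of_forall hb)

noncomputable def Gq (μ : Measure E7) (u : E7) (t : ℝ) : ℝ := ∫ y, th ((inner ℝ y u : ℝ) - t) ∂μ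

theorem th_meas' (u : E7) (t : ℝ) : Measurable fun y : E7 => th ((inner ℝ y u : ℝ) - t) :=
  th_meas.comp (by fun_prop)

theorem th_int (μ : Measure E7) [IsFiniteMeasure μ] (u : E7) (t : ℝ) :
    Integrable (fun y : E7 => th ((inner ℝ y u : ℝ) - t)) μ :=
  int_bdd μ _ (th_meas' u t) 1 fun y => by
    rw [abs_of_nonneg (th_nonneg _)]; exact th_le _

theorem Gq_cont (μ : Measure E7) [IsFiniteMeasure μ] (hac : μ ≪ volume) (u : E7) (t : ℝ)
    (h : u ≠ 0) : ContinuousAt (fun p : E7 × ℝ => Gq μ p.1 p.2) (u, t) := by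
  rw [← continuousWithinAt_univ]
  apply cont_int μ (fun p : E7 × ℝ => fun y => th ((inner ℝ y p.1 : ℝ) - p.2))
  · intro p; exact th_meas' _ _
  · intro p y; rw [abs_of_nonneg (th_nonneg _)]; exact th_le _
  · filter_upwards [hyp_null μ hac u t (Or.inl h)] with y hy
    rw [continuousWithinAt_univ]
    have h1 : ContinuousAt (fun p : E7 × ℝ => (inner ℝ y p.1 : ℝ) - p.2) (u, t) := by fun_prop
    exact ContinuousAt.comp (f := fun p : E7 × ℝ => (inner ℝ y p.1 : ℝ) - p.2) (th_cont hy) h1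

theorem Gq_anti (μ : Measure E7) [IsFiniteMeasure μ]
    (hpos : ∀ U : Set E7, IsOpen U → U.Nonempty → 0 < μ U) (u : E7) (hu : u ≠ 0) :
    StrictAnti (Gq μ u) := by
  intro t t' htt
  have : 0 < ∫ y, (th ((inner ℝ y u : ℝ) - t) - th ((inner ℝ y u : ℝ) - t')) ∂μ := by
    rw [integral_pos_iff_support_of_nonneg]
    · refine lt_of_lt_of_le (hpos {y | t < (inner ℝ y u : ℝ) ∧ (inner ℝ y u : ℝ) < t'} ?_ ?_)
        (measure_mono ?_)
      · have hc : Continuous fun y : E7 => (inner ℝ y u : ℝ) := by fun_prop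
        exact (isOpen_lt continuous_const hc).inter (isOpen_lt hc continuous_const)
      · refine ⟨(((t + t') / 2) / (inner ℝ u u : ℝ)) • u, ?_⟩
        have : (inner ℝ u u : ℝ) ≠ 0 := inner_self_ne_zero.2 hu
        simp only [Set.mem_ofPred_eq, real_inner_smul_left, div_mul_cancel₀ _ this]
        constructor <;> linarith
      · rintro y ⟨h1, h2⟩
        simp only [Function.mem_support]
        rw [th_pos (by linarith), th_neg (by linarith)]; norm_num
    · intro y
      simp only [Pi.zero_apply]
      by_cases h : t' < (inner ℝ y u : ℝ)
      · rw [th_pos (by linarith), th_pos (by linarith)]; simp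
      · rw [th_neg (r := (inner ℝ y u : ℝ) - t') (by linarith)]; simpa using th_nonneg _
    · exact (th_int μ u t).sub (th_int μ u t')
  rw [integral_sub (th_int μ u t) (th_int μ u t')] at this
  unfold Gq; linarith

theorem Gq_exists (μ : Measure E7) [IsFiniteMeasure μ] (hac : μ ≪ volume) (u : E7) (hu : u ≠ 0)
    (c : ℝ) (h0 : 0 < c) (h1 : c < μ.real Set.univ) : ∃ t, Gq μ u t = c := by
  have hc : Continuous (Gq μ u) := by
    rw [continuous_iff_continuousAt]
    intro t
    exact ContinuousAt.comp (f := fun t : ℝ => (u, t)) (Gq_cont μ hac u t hu) (by fun_prop)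
  have ltop : Tendsto (Gq μ u) atTop (𝓝 (∫ _, (0 : ℝ) ∂μ)) := by
    apply tendsto_integral_filter_of_dominated_convergence (bound := fun _ => 1)
    · exact Eventually.of_forall fun t => (th_meas' u t).aestronglyMeasurable
    · exact Eventually.of_forall fun t => Eventually.of_forall fun y => by
        rw [Real.norm_of_nonneg (th_nonneg _)]; exact th_le _
    · exact integrable_const _
    · refine Eventually.of_forall fun y => tendsto_const_nhds.congr' ?_
      filter_upwards [eventually_ge_atTop (inner ℝ y u : ℝ)] with t ht
      rw [th_neg (by linarith)]
  have lbot : Tendsto (Gq μ u) atBot (𝓝 (∫ _, (1 : ℝ) ∂μ)) := by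
    apply tendsto_integral_filter_of_dominated_convergence (bound := fun _ => 1)
    · exact Eventually.of_forall fun t => (th_meas' u t).aestronglyMeasurable
    · exact Eventually.of_forall fun t => Eventually.of_forall fun y => by
        rw [Real.norm_of_nonneg (th_nonneg _)]; exact th_le _
    · exact integrable_const _
    · refine Eventually.of_forall fun y => tendsto_const_nhds.congr' ?_
      filter_upwards [eventually_lt_atBot (inner ℝ y u : ℝ)] with t ht
      rw [th_pos (by linarith)]
  simp only [integral_zero, integral_const, smul_eq_mul, mul_one] at ltop lbot
  obtain ⟨a, ha⟩ := (ltop.eventually (gt_mem_nhds h0)).exists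
  obtain ⟨b, hb⟩ := (lbot.eventually (lt_mem_nhds h1)).exists
  exact mem_range_of_exists_le_of_exists_ge hc ⟨a, ha.le⟩ ⟨b, hb.le⟩

open Classical in
noncomputable def Tq (μ : Measure E7) (u : E7) (k : ℕ) : ℝ :=
  if h : ∃ t, Gq μ u t = μ.real Set.univ * (1 - k / 5) then h.choose else 0

/-- packaged assumptions on the measure -/
structure Good (μ : Measure E7) : Prop where
  fin : IsFiniteMeasure μ
  ac : μ ≪ volume
  pos : ∀ U : Set E7, IsOpen U → U.Nonempty → 0 < μ U

theorem Good.Mpos {μ : Measure E7} (h : Good μ) : 0 < μ.real Set.univ := by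
  have := h.fin
  rw [measureReal_def]
  exact ENNReal.toReal_pos (h.pos _ isOpen_univ Set.univ_nonempty).ne' (measure_ne_top _ _)

theorem Tq_spec {μ : Measure E7} (h : Good μ) (u : E7) (hu : u ≠ 0) (k : ℕ) (h1 : 1 ≤ k) (h4 : k ≤ 4) :
    Gq μ u (Tq μ u k) = μ.real Set.univ * (1 - k / 5) := by
  have := h.fin
  have hk1 : (1 : ℝ) ≤ k := by exact_mod_cast h1
  have hk4 : (k : ℝ) ≤ 4 := by exact_mod_cast h4
  have hM := h.Mpos
  have hex := Gq_exists μ h.ac u hu (μ.real Set.univ * (1 - k / 5))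
    (mul_pos hM (by linarith)) (by nlinarith)
  unfold Tq
  rw [dif_pos hex]
  exact hex.choose_spec

theorem Tq_mono {μ : Measure E7} (h : Good μ) (u : E7) (hu : u ≠ 0) (k k' : ℕ) (h1 : 1 ≤ k)
    (hk : k < k') (h4 : k' ≤ 4) : Tq μ u k < Tq μ u k' := by
  have := h.fin
  have a := Tq_spec h u hu k h1 (by omega)
  have b := Tq_spec h u hu k' (by omega) h4
  have hM := h.Mpos
  have hk' : (k : ℝ) < k' := by exact_mod_cast hk
  rw [← (Gq_anti μ h.pos u hu).lt_iff_gt, a, b]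
  apply mul_lt_mul_of_pos_left _ hM
  linarith

theorem Gq_neg {μ : Measure E7} (h : Good μ) (u : E7) (hu : u ≠ 0) (t : ℝ) :
    Gq μ (-u) (-t) = μ.real Set.univ - Gq μ u t := by
  have := h.fin
  unfold Gq
  have : ∫ y, (1 : ℝ) ∂μ = μ.real Set.univ := by simp
  rw [← this, ← integral_sub (integrable_const _) (th_int μ u t)]
  apply integral_congr_ae
  filter_upwards [hyp_null μ h.ac u t (Or.inl hu)] with y hy
  rw [← th_flip hy]
  congr 1
  rw [inner_neg_right]; ring

theorem Tq_neg {μ : Measure E7} (h : Good μ) (u : E7) (hu : u ≠ 0) (k : ℕ) (h1 : 1 ≤ k) (h4 : k ≤ 4) :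
    Tq μ (-u) k = - Tq μ u (5 - k) := by
  have := h.fin
  have a := Tq_spec h (-u) (neg_ne_zero.2 hu) k h1 h4
  have b := Tq_spec h u hu (5 - k) (by omega) (by omega)
  have c := Gq_neg h u hu (Tq μ u (5 - k))
  apply (Gq_anti μ h.pos (-u) (neg_ne_zero.2 hu)).injective
  rw [a, c, b]
  push_cast [Nat.cast_sub (show k ≤ 5 by omega)]
  ring

theorem Tq_cont {μ : Measure E7} (h : Good μ) (u : E7) (hu : u ≠ 0) (k : ℕ) (h1 : 1 ≤ k) (h4 : k ≤ 4) :
    ContinuousAt (fun u => Tq μ u k) u := by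
  have := h.fin
  have hne : ∀ᶠ u' in 𝓝 u, u' ≠ 0 := isOpen_ne.mem_nhds hu
  have hsl : ∀ t, ContinuousAt (fun u' => Gq μ u' t) u := fun t =>
    ContinuousAt.comp (f := fun u' : E7 => (u', t)) (Gq_cont μ h.ac u t hu) (by fun_prop)
  have hsp := Tq_spec h u hu k h1 h4
  have hanti := Gq_anti μ h.pos u hu
  unfold ContinuousAt
  rw [tendsto_order]
  constructor
  · intro a ha
    have : μ.real Set.univ * (1 - k / 5) < Gq μ u a := by rw [← hsp]; exact hanti ha
    filter_upwards [hne, (hsl a).eventually (lt_mem_nhds this)] with u' hu' hlt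
    rw [← Tq_spec h u' hu' k h1 h4] at hlt
    exact (Gq_anti μ h.pos u' hu').lt_iff_gt.1 hlt
  · intro a ha
    have : Gq μ u a < μ.real Set.univ * (1 - k / 5) := by rw [← hsp]; exact hanti ha
    filter_upwards [hne, (hsl a).eventually (gt_mem_nhds this)] with u' hu' hlt
    rw [← Tq_spec h u' hu' k h1 h4] at hlt
    exact (Gq_anti μ h.pos u' hu').lt_iff_gt.1 hlt


noncomputable def toU (v : Fin 8 → ℝ) : E7 := WithLp.toLp 2 (fun i : Fin 7 => v i.castSucc)

theorem toU_neg (v : Fin 8 → ℝ) : toU (-v) = - toU v := by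
  ext i; simp [toU]

theorem toU_cont : Continuous toU := by
  unfold toU; fun_prop

theorem toU_ne (v : Fin 8 → ℝ) (h : v ≠ 0) : toU v ≠ 0 ∨ v (Fin.last 7) ≠ 0 := by
  by_contra hc
  push Not at hc
  apply h
  funext m
  refine Fin.lastCases hc.2 (fun i => ?_) m
  have := congrArg (fun w : E7 => w i) hc.1
  simpa [toU] using this

noncomputable def gg (v : Fin 8 → ℝ) (y : E7) : ℝ := (inner ℝ y (toU v) : ℝ) - v (Fin.last 7)

theorem gg_neg (v y) : gg (-v) y = - gg v y := by
  simp only [gg, toU_neg, inner_neg_right, Pi.neg_apply]; ring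

theorem gg_meas (v) : Measurable (gg v) := by unfold gg; fun_prop

theorem gg_cont (y) : Continuous fun v => gg v y := by
  unfold gg
  have := toU_cont
  fun_prop

theorem gg_null {μ : Measure E7} (h : Good μ) (v : Fin 8 → ℝ) (hv : v ≠ 0) :
    ∀ᵐ y ∂μ, gg v y ≠ 0 := hyp_null μ h.ac _ _ (toU_ne v hv)

noncomputable def sgn (r : ℝ) : ℝ := th r - th (-r)

theorem sgn_neg (r : ℝ) : sgn (-r) = - sgn r := by simp [sgn]
theorem sgn_meas : Measurable sgn := th_meas.sub (th_meas.comp measurable_neg)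
theorem sgn_abs (r : ℝ) : |sgn r| ≤ 1 := by
  rw [abs_le]; unfold sgn
  have := th_nonneg r; have := th_nonneg (-r); have := th_le r; have := th_le (-r)
  constructor <;> linarith
theorem sgn_cont {r : ℝ} (h : r ≠ 0) : ContinuousAt sgn r :=
  (th_cont h).sub (ContinuousAt.comp (f := fun r : ℝ => -r) (th_cont (neg_ne_zero.2 h)) (by fun_prop))

noncomputable def qq (μ : Measure E7) (u : E7) (k : ℕ) (y : E7) : ℝ :=
  if k = 0 then 1 else if 5 ≤ k then 0 else th ((inner ℝ y u : ℝ) - Tq μ u k)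

theorem qq_meas (μ u k) : Measurable (qq μ u k) := by
  unfold qq
  split_ifs
  · exact measurable_const
  · exact measurable_const
  · exact th_meas' _ _

theorem qq_nonneg (μ u k y) : 0 ≤ qq μ u k y := by
  unfold qq; split_ifs
  · norm_num
  · norm_num
  · exact th_nonneg _

theorem qq_le (μ u k y) : qq μ u k y ≤ 1 := by
  unfold qq; split_ifs
  · norm_num
  · norm_num
  · exact th_le _

theorem qq_cont {μ : Measure E7} (h : Good μ) (u : E7) (hu : u ≠ 0) (k : ℕ) :
    ∀ᵐ y ∂μ, ContinuousAt (fun u => qq μ u k y) u := by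
  unfold qq
  split_ifs with h1 h2
  · exact Eventually.of_forall fun y => continuousAt_const
  · exact Eventually.of_forall fun y => continuousAt_const
  · filter_upwards [hyp_null μ h.ac u (Tq μ u k) (Or.inl hu)] with y hy
    have hT := Tq_cont h u hu k (by omega) (by omega)
    have h3 : ContinuousAt (fun u : E7 => (inner ℝ y u : ℝ) - Tq μ u k) u :=
      ContinuousAt.sub (by fun_prop) hT
    exact ContinuousAt.comp (f := fun u : E7 => (inner ℝ y u : ℝ) - Tq μ u k) (th_cont hy) h3

theorem qq_neg {μ : Measure E7} (h : Good μ) (u : E7) (hu : u ≠ 0) (k : ℕ) (hk : k ≤ 5) :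
    ∀ᵐ y ∂μ, qq μ (-u) k y = 1 - qq μ u (5 - k) y := by
  filter_upwards [hyp_null μ h.ac u (Tq μ u (5 - k)) (Or.inl hu)] with y hy
  unfold qq
  by_cases h0 : k = 0
  · subst h0; simp
  by_cases h5 : k = 5
  · subst h5; simp
  rw [if_neg h0, if_neg (by omega), if_neg (by omega), if_neg (by omega),
    Tq_neg h u hu k (by omega) (by omega), ← th_flip hy, inner_neg_right]
  congr 1; ring

/-- admissible sign functions -/
structure GoodZ (μ : Measure E7) (Z : V3 → E7 → ℝ) (b1 b2 : Bool) : Prop where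
  meas : ∀ x, Measurable (Z x)
  bd : ∀ x y, |Z x y| ≤ 1
  cont : ∀ x, x 1 ≠ 0 → x 2 ≠ 0 → ∀ᵐ y ∂μ, ContinuousAt (fun x => Z x y) x
  t0 : ∀ x y, Z (Tk 0 x) y = Z x y
  t1 : ∀ x y, Z (Tk 1 x) y = (if b1 then -1 else 1) * Z x y
  t2 : ∀ x y, Z (Tk 2 x) y = (if b2 then -1 else 1) * Z x y

noncomputable def AA (μ : Measure E7) (Z : V3 → E7 → ℝ) (i : ℕ) (x : V3) : ℝ :=
  ∫ y, (qq μ (toU (x 0)) i y - qq μ (toU (x 0)) (i + 1) y) * Z x y ∂μ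

theorem AA_bd {μ : Measure E7} {Z b1 b2} (hZ : GoodZ μ Z b1 b2) (i x y u) :
    |(qq μ u i y - qq μ u (i + 1) y) * Z x y| ≤ 1 := by
  rw [abs_mul]
  have h1 : |qq μ u i y - qq μ u (i + 1) y| ≤ 1 := by
    rw [abs_le]
    have := qq_nonneg μ u i y; have := qq_nonneg μ u (i+1) y
    have := qq_le μ u i y; have := qq_le μ u (i+1) y
    constructor <;> linarith
  exact mul_le_one₀ h1 (abs_nonneg _) (hZ.bd x y)

theorem AA_meas {μ : Measure E7} {Z b1 b2} (hZ : GoodZ μ Z b1 b2) (i x u) :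
    Measurable fun y => (qq μ u i y - qq μ u (i + 1) y) * Z x y :=
  ((qq_meas μ u i).sub (qq_meas μ u (i+1))).mul (hZ.meas x)

theorem AA_int {μ : Measure E7} (h : Good μ) {Z b1 b2} (hZ : GoodZ μ Z b1 b2) (i x u) :
    Integrable (fun y => (qq μ u i y - qq μ u (i + 1) y) * Z x y) μ := by
  have := h.fin
  exact int_bdd μ _ (AA_meas hZ i x u) 1 fun y => AA_bd hZ i x y u

theorem AA_cont {μ : Measure E7} (h : Good μ) {Z b1 b2} (hZ : GoodZ μ Z b1 b2) (i : ℕ) (x : V3)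
    (hx0 : toU (x 0) ≠ 0) (hx1 : x 1 ≠ 0) (hx2 : x 2 ≠ 0) : ContinuousAt (AA μ Z i) x := by
  have := h.fin
  rw [← continuousWithinAt_univ]
  apply cont_int μ (fun x : V3 => fun y =>
    (qq μ (toU (x 0)) i y - qq μ (toU (x 0)) (i + 1) y) * Z x y)
  · intro x; exact AA_meas hZ i x _
  · intro x y; exact AA_bd hZ i x y _
  · have hU : ContinuousAt (fun x : V3 => toU (x 0)) x :=
      (toU_cont.comp (continuous_apply 0)).continuousAt
    filter_upwards [qq_cont h _ hx0 i, qq_cont h _ hx0 (i + 1), hZ.cont x hx1 hx2] with y h1 h2 h3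
    rw [continuousWithinAt_univ]
    exact ((ContinuousAt.comp (f := fun x : V3 => toU (x 0)) h1 hU).sub
      (ContinuousAt.comp (f := fun x : V3 => toU (x 0)) h2 hU)).mul h3

theorem AA_flip {μ : Measure E7} (h : Good μ) {Z b1 b2} (hZ : GoodZ μ Z b1 b2) (i : ℕ) (hi : i ≤ 4)
    (x : V3) (hx0 : toU (x 0) ≠ 0) : AA μ Z i (Tk 0 x) = AA μ Z (4 - i) x := by
  unfold AA
  apply integral_congr_ae
  filter_upwards [qq_neg h _ hx0 i (by omega), qq_neg h _ hx0 (i + 1) (by omega)] with y h1 h2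
  have e : Tk 0 x 0 = - x 0 := by simp [Tk]
  rw [e, toU_neg, h1, h2, hZ.t0, show 5 - (i + 1) = 4 - i by omega, show 5 - i = 4 - i + 1 by omega]
  ring

theorem AA_sgn1 {μ : Measure E7} {Z b1 b2} (hZ : GoodZ μ Z b1 b2) (i : ℕ)
    (x : V3) : AA μ Z i (Tk 1 x) = (if b1 then -1 else 1) * AA μ Z i x := by
  unfold AA
  rw [← integral_const_mul]
  congr 1; funext y
  have e : Tk 1 x 0 = x 0 := by simp [Tk]
  rw [e, hZ.t1]; ring

theorem AA_sgn2 {μ : Measure E7} {Z b1 b2} (hZ : GoodZ μ Z b1 b2) (i : ℕ)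
    (x : V3) : AA μ Z i (Tk 2 x) = (if b2 then -1 else 1) * AA μ Z i x := by
  unfold AA
  rw [← integral_const_mul]
  congr 1; funext y
  have e : Tk 2 x 0 = x 0 := by simp [Tk]
  rw [e, hZ.t2]; ring

noncomputable def flZ (μ : Measure E7) (Z : V3 → E7 → ℝ) (b1 b2 : Bool) :
    List ((V3 → ℝ) × (Bool × Bool × Bool)) :=
  [(fun x => AA μ Z 0 x + AA μ Z 4 x, (false, b1, b2)),
   (fun x => AA μ Z 1 x + AA μ Z 3 x, (false, b1, b2)),
   (fun x => AA μ Z 2 x, (false, b1, b2)),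
   (fun x => AA μ Z 0 x - AA μ Z 4 x, (true, b1, b2)),
   (fun x => AA μ Z 1 x - AA μ Z 3 x, (true, b1, b2))]

theorem flZ_equiv {μ : Measure E7} (h : Good μ) {Z b1 b2} (hZ : GoodZ μ Z b1 b2) :
    ∀ q ∈ flZ μ Z b1 b2, ∀ x : V3, toU (x 0) ≠ 0 → ∀ k,
      q.1 (Tk k x) = (if chiB q.2 k then -1 else 1) * q.1 x := by
  intro q hq x hx k
  have f0 := AA_flip h hZ 0 (by norm_num) x hx
  have f1 := AA_flip h hZ 1 (by norm_num) x hx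
  have f2 := AA_flip h hZ 2 (by norm_num) x hx
  have f3 := AA_flip h hZ 3 (by norm_num) x hx
  have f4 := AA_flip h hZ 4 (by norm_num) x hx
  norm_num at f0 f1 f2 f3 f4
  have s1 := fun i => AA_sgn1 hZ i x
  have s2 := fun i => AA_sgn2 hZ i x
  simp only [flZ, List.mem_cons, List.not_mem_nil, or_false] at hq
  fin_cases k
  · rcases hq with rfl | rfl | rfl | rfl | rfl <;> simp [chiB, f0, f1, f2, f3, f4] <;> ring
  · cases b1 <;> rcases hq with rfl | rfl | rfl | rfl | rfl <;> simp [chiB, s1] <;> ring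
  · cases b2 <;> rcases hq with rfl | rfl | rfl | rfl | rfl <;> simp [chiB, s2] <;> ring

theorem flZ_cont {μ : Measure E7} (h : Good μ) {Z b1 b2} (hZ : GoodZ μ Z b1 b2) :
    ∀ q ∈ flZ μ Z b1 b2, ∀ x : V3, toU (x 0) ≠ 0 → x 1 ≠ 0 → x 2 ≠ 0 → ContinuousAt q.1 x := by
  intro q hq x h0 h1 h2
  have c := fun i => AA_cont h hZ i x h0 h1 h2
  simp only [flZ, List.mem_cons, List.not_mem_nil, or_false] at hq
  rcases hq with rfl | rfl | rfl | rfl | rfl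
  · exact (c 0).add (c 4)
  · exact (c 1).add (c 3)
  · exact c 2
  · exact (c 0).sub (c 4)
  · exact (c 1).sub (c 3)

theorem flZ_zero {μ : Measure E7} {Z b1 b2} (x : V3)
    (hz : ∀ q ∈ flZ μ Z b1 b2, q.1 x = 0) (i : ℕ) (hi : i ≤ 4) : AA μ Z i x = 0 := by
  simp only [flZ, List.mem_cons, List.not_mem_nil, or_false, forall_eq_or_imp, forall_eq] at hz
  obtain ⟨a, b, c, d, e⟩ := hz
  interval_cases i <;> linarith

noncomputable def Z1 (x : V3) (y : E7) : ℝ := sgn (gg (x 1) y)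
noncomputable def Z2 (x : V3) (y : E7) : ℝ := sgn (gg (x 2) y)
noncomputable def Z3 (x : V3) (y : E7) : ℝ := Z1 x y * Z2 x y

theorem gZ1 {μ : Measure E7} (h : Good μ) : GoodZ μ Z1 true false where
  meas x := sgn_meas.comp (gg_meas _)
  bd x y := sgn_abs _
  cont x h1 h2 := by
    filter_upwards [gg_null h _ h1] with y hy
    exact ContinuousAt.comp (f := fun x : V3 => gg (x 1) y) (sgn_cont hy)
      ((gg_cont y).comp (continuous_apply 1)).continuousAt
  t0 x y := by simp [Z1, Tk]
  t1 x y := by simp [Z1, Tk, gg_neg, sgn_neg]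
  t2 x y := by simp [Z1, Tk]

theorem gZ2 {μ : Measure E7} (h : Good μ) : GoodZ μ Z2 false true where
  meas x := sgn_meas.comp (gg_meas _)
  bd x y := sgn_abs _
  cont x h1 h2 := by
    filter_upwards [gg_null h _ h2] with y hy
    exact ContinuousAt.comp (f := fun x : V3 => gg (x 2) y) (sgn_cont hy)
      ((gg_cont y).comp (continuous_apply 2)).continuousAt
  t0 x y := by simp [Z2, Tk]
  t1 x y := by simp [Z2, Tk]
  t2 x y := by simp [Z2, Tk, gg_neg, sgn_neg]

theorem gZ3 {μ : Measure E7} (h : Good μ) : GoodZ μ Z3 true true where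
  meas x := ((gZ1 h).meas x).mul ((gZ2 h).meas x)
  bd x y := by
    unfold Z3; rw [abs_mul]; exact mul_le_one₀ ((gZ1 h).bd x y) (abs_nonneg _) ((gZ2 h).bd x y)
  cont x h1 h2 := by
    filter_upwards [(gZ1 h).cont x h1 h2, (gZ2 h).cont x h1 h2] with y a b
    exact a.mul b
  t0 x y := by unfold Z3; rw [(gZ1 h).t0, (gZ2 h).t0]
  t1 x y := by unfold Z3; rw [(gZ1 h).t1, (gZ2 h).t1]; simp
  t2 x y := by unfold Z3; rw [(gZ1 h).t2, (gZ2 h).t2]; simp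

theorem Hs_ne {i : ℤ} {v : Fin 8 → ℝ} (h : v ∈ Hs i) : v ≠ 0 := by
  rintro rfl
  have := h.2.2
  simp at this

theorem exists_zero {μ : Measure E7} (h : Good μ) : ∃ x : V3, toU (x 0) ≠ 0 ∧ x 1 ≠ 0 ∧ x 2 ≠ 0 ∧
    ∀ i ≤ 4, AA μ Z1 i x = 0 ∧ AA μ Z2 i x = 0 ∧ AA μ Z3 i x = 0 := by
  set Ω : Set V3 := {x | toU (x 0) ≠ 0 ∧ x 1 ≠ 0 ∧ x 2 ≠ 0} with hΩ
  have hD : ∀ n : Fin 3 → ℤ, n ≤ ![6, 6, 3] → Dn n ⊆ Ω := by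
    intro n hn x hx
    refine ⟨?_, Hs_ne (hx 1), Hs_ne (hx 2)⟩
    rcases toU_ne _ (Hs_ne (hx 0)) with h1 | h1
    · exact h1
    · exfalso
      apply h1
      have := hn 0
      simp at this
      apply (hx 0).1
      simp
      omega
  obtain ⟨x, hx, hz⟩ := zero_exists Ω (fun x hx k => by
      fin_cases k
      · intro h0
        apply hx.1
        simp only [Fin.zero_eta] at h0
        rw [h0]; ext i; simp [toU]
      · exact hx.2.1
      · exact hx.2.2) hD
    (flZ μ Z1 true false ++ flZ μ Z2 false true ++ flZ μ Z3 true true) rfl cB_val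
    (by
      intro q hq x hx
      apply ContinuousAt.continuousWithinAt
      obtain ⟨h0, h1, h2⟩ := hD _ le_rfl hx
      simp only [List.mem_append] at hq
      rcases hq with (hq | hq) | hq
      · exact flZ_cont h (gZ1 h) q hq x h0 h1 h2
      · exact flZ_cont h (gZ2 h) q hq x h0 h1 h2
      · exact flZ_cont h (gZ3 h) q hq x h0 h1 h2)
    (by
      intro q hq x hx k
      simp only [List.mem_append] at hq
      rcases hq with (hq | hq) | hq
      · exact flZ_equiv h (gZ1 h) q hq x hx.1 k
      · exact flZ_equiv h (gZ2 h) q hq x hx.1 k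
      · exact flZ_equiv h (gZ3 h) q hq x hx.1 k)
  obtain ⟨h0, h1, h2⟩ := hD _ le_rfl hx
  simp only [List.mem_append] at hz
  exact ⟨x, h0, h1, h2, fun i hi => ⟨flZ_zero x (fun q hq => hz q (by tauto)) i hi,
    flZ_zero x (fun q hq => hz q (by tauto)) i hi, flZ_zero x (fun q hq => hz q (by tauto)) i hi⟩⟩

theorem qq_total {μ : Measure E7} (h : Good μ) (u : E7) (hu : u ≠ 0) (k : ℕ) (hk : k ≤ 5) :
    ∫ y, qq μ u k y ∂μ = μ.real Set.univ * (1 - k / 5) := by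
  have := h.fin
  by_cases h0 : k = 0
  · subst h0; simp [qq]
  by_cases h5 : k = 5
  · subst h5; simp [qq]
  rw [← Tq_spec h u hu k (by omega) (by omega)]
  unfold qq Gq
  simp only [h0, if_false, show ¬ (5 ≤ k) by omega]

theorem qq_int {μ : Measure E7} (h : Good μ) (u : E7) (k : ℕ) : Integrable (qq μ u k) μ := by
  have := h.fin
  exact int_bdd μ _ (qq_meas μ u k) 1 fun y => by
    rw [abs_of_nonneg (qq_nonneg _ _ _ _)]; exact qq_le _ _ _ _

/-- signed half space weight -/
noncomputable def hw (b : Bool) (r : ℝ) : ℝ := th (if b then -r else r)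

theorem hw_eq (b : Bool) {r : ℝ} (hr : r ≠ 0) :
    hw b r = (1 + (if b then -1 else 1) * sgn r) / 2 := by
  unfold hw sgn
  cases b
  · simp [th_flip hr]; ring
  · simp [th_flip hr]; ring

theorem box_int {μ : Measure E7} (h : Good μ) (x : V3) (h0 : toU (x 0) ≠ 0) (h1 : x 1 ≠ 0)
    (h2 : x 2 ≠ 0) (i : ℕ) (hi : i ≤ 4) (a1 : AA μ Z1 i x = 0) (a2 : AA μ Z2 i x = 0)
    (a3 : AA μ Z3 i x = 0) (b c : Bool) :
    ∫ y, (qq μ (toU (x 0)) i y - qq μ (toU (x 0)) (i + 1) y) * (hw b (gg (x 1) y) * hw c (gg (x 2) y)) ∂μ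
      = μ.real Set.univ / 20 := by
  have := h.fin
  set u := toU (x 0) with hu
  set β : ℝ := if b then -1 else 1
  set γ : ℝ := if c then -1 else 1
  have e : ∫ y, (qq μ u i y - qq μ u (i + 1) y) * (hw b (gg (x 1) y) * hw c (gg (x 2) y)) ∂μ =
      ∫ y, (1 / 4 * (qq μ u i y - qq μ u (i + 1) y) +
        β / 4 * ((qq μ u i y - qq μ u (i + 1) y) * Z1 x y) +
        γ / 4 * ((qq μ u i y - qq μ u (i + 1) y) * Z2 x y) +
        β * γ / 4 * ((qq μ u i y - qq μ u (i + 1) y) * Z3 x y)) ∂μ := by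
    apply integral_congr_ae
    filter_upwards [gg_null h _ h1, gg_null h _ h2] with y hy1 hy2
    rw [hw_eq b hy1, hw_eq c hy2]
    simp only [Z3, Z1, Z2]
    ring
  have i0 : Integrable (fun y => 1 / 4 * (qq μ u i y - qq μ u (i + 1) y)) μ :=
    ((qq_int h u i).sub (qq_int h u (i+1))).const_mul _
  have i1 : Integrable (fun y => β / 4 * ((qq μ u i y - qq μ u (i + 1) y) * Z1 x y)) μ :=
    (AA_int h (gZ1 h) i x u).const_mul _
  have i2 : Integrable (fun y => γ / 4 * ((qq μ u i y - qq μ u (i + 1) y) * Z2 x y)) μ :=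
    (AA_int h (gZ2 h) i x u).const_mul _
  have i3 : Integrable (fun y => β * γ / 4 * ((qq μ u i y - qq μ u (i + 1) y) * Z3 x y)) μ :=
    (AA_int h (gZ3 h) i x u).const_mul _
  have i01 : Integrable (fun y => 1 / 4 * (qq μ u i y - qq μ u (i + 1) y) +
        β / 4 * ((qq μ u i y - qq μ u (i + 1) y) * Z1 x y)) μ := i0.add i1
  have i012 : Integrable (fun y => 1 / 4 * (qq μ u i y - qq μ u (i + 1) y) +
        β / 4 * ((qq μ u i y - qq μ u (i + 1) y) * Z1 x y) +
        γ / 4 * ((qq μ u i y - qq μ u (i + 1) y) * Z2 x y)) μ := i01.add i2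
  rw [e, integral_add i012 i3, integral_add i01 i2, integral_add i0 i1,
    integral_const_mul, integral_const_mul, integral_const_mul, integral_const_mul,
    integral_sub (qq_int h u i) (qq_int h u (i + 1)), qq_total h u h0 i (by omega),
    qq_total h u h0 (i + 1) (by omega)]
  unfold AA at a1 a2 a3
  rw [a1, a2, a3]
  push_cast
  ring



theorem hw_true (r : ℝ) : hw true r = th (-r) := by simp [hw]
theorem hw_false (r : ℝ) : hw false r = th r := by simp [hw]

theorem toU_ne_zero_of {μ : Measure E7} (h : Good μ) (v : Fin 8 → ℝ) (hv : v ≠ 0)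
    (P : Bool → E7 → ℝ) (hP : ∀ b, ∫ y, P b y * hw b (gg v y) ∂μ = μ.real Set.univ / 20) :
    toU v ≠ 0 := by
  intro h0
  have hM := h.Mpos
  have hg : ∀ y, gg v y = - v (Fin.last 7) := by intro y; simp [gg, h0]
  rcases toU_ne v hv with h1 | h1
  · exact h1 h0
  rcases lt_or_gt_of_ne h1 with h2 | h2
  · have := hP true
    simp only [hg, hw_true, neg_neg, th_neg h2.le, mul_zero, integral_zero] at this
    linarith
  · have := hP false
    simp only [hg, hw_false, th_neg (neg_nonpos.2 h2.le), mul_zero, integral_zero] at this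
    linarith

/-- unnormalised slab weight -/
theorem slab_weight {μ : Measure E7} (h : Good μ) (u : E7) (hu : u ≠ 0) (i : ℕ) (hi : i ≤ 4)
    (y : E7) (hy : ∀ k ∈ Finset.range 6, (inner ℝ y u : ℝ) - Tq μ u k ≠ 0) :
    ((1 ≤ i → Tq μ u i < (inner ℝ y u : ℝ)) ∧ (i + 1 ≤ 4 → (inner ℝ y u : ℝ) < Tq μ u (i + 1)) ∧
      qq μ u i y - qq μ u (i + 1) y = 1) ∨
    (¬ ((1 ≤ i → Tq μ u i < (inner ℝ y u : ℝ)) ∧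
      (i + 1 ≤ 4 → (inner ℝ y u : ℝ) < Tq μ u (i + 1))) ∧
      qq μ u i y - qq μ u (i + 1) y = 0) := by
  have ne := fun k hk => hy k (Finset.mem_range.2 hk)
  unfold qq
  by_cases h0 : i = 0
  · subst h0
    rcases lt_or_gt_of_ne (ne 1 (by norm_num)) with g | g
    · left; simp [th_neg g.le]; linarith
    · right; simp [th_pos g]; linarith
  by_cases h4 : i = 4
  · subst h4
    rcases lt_or_gt_of_ne (ne 4 (by norm_num)) with g | g
    · right; simp [th_neg g.le]; linarith
    · left; simp [th_pos g]; linarith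
  have hm := Tq_mono h u hu i (i + 1) (by omega) (by omega) (by omega)
  rw [if_neg h0, if_neg (by omega), if_neg (by omega), if_neg (by omega)]
  have e1 : 1 ≤ i := by omega
  have e2 : i + 1 ≤ 4 := by omega
  simp only [e1, e2, forall_const]
  rcases lt_or_gt_of_ne (ne i (by omega)) with g | g
  · right
    rw [th_neg g.le, th_neg (by linarith)]
    refine ⟨fun hh => ?_, by simp⟩
    linarith [hh.1]
  · rcases lt_or_gt_of_ne (ne (i + 1) (by omega)) with g' | g'
    · left
      rw [th_pos g, th_neg g'.le]
      exact ⟨by linarith, by linarith, by simp⟩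
    · right
      rw [th_pos g, th_pos g']
      refine ⟨fun hh => ?_, by simp⟩
      linarith [hh.2]

theorem mem_slab_scaled {u : E7} (hu : u ≠ 0) (T : ℕ → ℝ) (i : ℕ) (y : E7) :
    y ∈ slab (‖u‖⁻¹ • u) (fun k => ‖u‖⁻¹ * T k) 4 i ↔
      (1 ≤ i → T i < (inner ℝ y u : ℝ)) ∧ (i + 1 ≤ 4 → (inner ℝ y u : ℝ) < T (i + 1)) := by
  have hp : 0 < ‖u‖⁻¹ := inv_pos.2 (norm_pos_iff.2 hu)
  change (_ ∧ _) ↔ _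
  rw [inner_smul_right, mul_lt_mul_iff_right₀ hp, mul_lt_mul_iff_right₀ hp]

theorem mem_half {v : E7} {s : ℝ} {b : Bool} {y : E7} : y ∈ halfSp v s b ↔
    if b then (inner ℝ y v : ℝ) < s else s < (inner ℝ y v : ℝ) := by
  cases b <;> simp [halfSp]

theorem half_weight (v : Fin 8 → ℝ) (hv : toU v ≠ 0) (b : Bool) (y : E7) :
    (y ∈ halfSp (‖toU v‖⁻¹ • toU v) (‖toU v‖⁻¹ * v (Fin.last 7)) b ∧ hw b (gg v y) = 1) ∨
    (y ∉ halfSp (‖toU v‖⁻¹ • toU v) (‖toU v‖⁻¹ * v (Fin.last 7)) b ∧ hw b (gg v y) = 0) := by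
  have hp : 0 < ‖toU v‖⁻¹ := inv_pos.2 (norm_pos_iff.2 hv)
  rw [mem_half, inner_smul_right, mul_lt_mul_iff_right₀ hp, mul_lt_mul_iff_right₀ hp]
  cases b
  · rw [hw_false]
    rcases le_or_gt (gg v y) 0 with g | g
    · right; refine ⟨?_, th_neg g⟩; unfold gg at g; simp [-Fin.reduceLast]; linarith
    · left; refine ⟨?_, th_pos g⟩; unfold gg at g; simp [-Fin.reduceLast]; linarith
  · rw [hw_true]
    rcases le_or_gt 0 (gg v y) with g | g
    · right; refine ⟨?_, th_neg (by linarith)⟩; unfold gg at g; simp [-Fin.reduceLast]; linarith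
    · left; refine ⟨?_, th_pos (by linarith)⟩; unfold gg at g; simp [-Fin.reduceLast]; linarith

theorem half_meas (v : E7) (s : ℝ) (b : Bool) : MeasurableSet (halfSp v s b) := by
  cases b
  · have : halfSp v s false = (fun y : E7 => (inner ℝ y v : ℝ)) ⁻¹' Set.Ioi s := by
      ext y; simp [halfSp]
    rw [this]
    exact (show Measurable fun y : E7 => (inner ℝ y v : ℝ) by fun_prop) measurableSet_Ioi
  · have : halfSp v s true = (fun y : E7 => (inner ℝ y v : ℝ)) ⁻¹' Set.Iio s := by
      ext y; simp [halfSp]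
    rw [this]
    exact (show Measurable fun y : E7 => (inner ℝ y v : ℝ) by fun_prop) measurableSet_Iio

theorem slab_meas (u : E7) (t : ℕ → ℝ) (n i : ℕ) : MeasurableSet (slab u t n i) := by
  have hi : Measurable fun y : E7 => (inner ℝ y u : ℝ) := by fun_prop
  have : slab u t n i = {y : E7 | 1 ≤ i → t i < (inner ℝ y u : ℝ)} ∩
      {y : E7 | i + 1 ≤ n → (inner ℝ y u : ℝ) < t (i + 1)} := rfl
  rw [this]
  apply MeasurableSet.inter
  · by_cases hh : 1 ≤ i
    · simp only [hh, forall_const]; exact measurableSet_lt measurable_const hi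
    · simp [hh]
  · by_cases hh : i + 1 ≤ n
    · simp only [hh, forall_const]; exact measurableSet_lt hi measurable_const
    · simp [hh]

theorem box_measure {μ : Measure E7} (h : Good μ) (x : V3) (h0 : toU (x 0) ≠ 0)
    (h1 : toU (x 1) ≠ 0) (h2 : toU (x 2) ≠ 0) (i : ℕ) (hi : i ≤ 4) (b c : Bool)
    (hI : ∫ y, (qq μ (toU (x 0)) i y - qq μ (toU (x 0)) (i + 1) y) *
      (hw b (gg (x 1) y) * hw c (gg (x 2) y)) ∂μ = μ.real Set.univ / 20) :
    μ (slab (‖toU (x 0)‖⁻¹ • toU (x 0)) (fun k => ‖toU (x 0)‖⁻¹ * Tq μ (toU (x 0)) k) 4 i ∩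
      halfSp (‖toU (x 1)‖⁻¹ • toU (x 1)) (‖toU (x 1)‖⁻¹ * x 1 (Fin.last 7)) b ∩
      halfSp (‖toU (x 2)‖⁻¹ • toU (x 2)) (‖toU (x 2)‖⁻¹ * x 2 (Fin.last 7)) c) =
    μ Set.univ / 20 := by
  have := h.fin
  set B := slab (‖toU (x 0)‖⁻¹ • toU (x 0)) (fun k => ‖toU (x 0)‖⁻¹ * Tq μ (toU (x 0)) k) 4 i ∩
      halfSp (‖toU (x 1)‖⁻¹ • toU (x 1)) (‖toU (x 1)‖⁻¹ * x 1 (Fin.last 7)) b ∩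
      halfSp (‖toU (x 2)‖⁻¹ • toU (x 2)) (‖toU (x 2)‖⁻¹ * x 2 (Fin.last 7)) c with hB
  have hBm : MeasurableSet B := ((slab_meas _ _ _ _).inter (half_meas _ _ _)).inter (half_meas _ _ _)
  have hne : ∀ᵐ y ∂μ, ∀ k ∈ Finset.range 6, (inner ℝ y (toU (x 0)) : ℝ) - Tq μ (toU (x 0)) k ≠ 0 := by
    rw [Filter.eventually_all_finset]
    intro k _
    exact hyp_null μ h.ac _ _ (Or.inl h0)
  have e : ∫ y, (qq μ (toU (x 0)) i y - qq μ (toU (x 0)) (i + 1) y) *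
      (hw b (gg (x 1) y) * hw c (gg (x 2) y)) ∂μ = ∫ y, B.indicator 1 y ∂μ := by
    apply integral_congr_ae
    filter_upwards [hne] with y hy
    have m0 := mem_slab_scaled h0 (Tq μ (toU (x 0))) i y
    by_cases hyB : y ∈ B
    · rw [Set.indicator_of_mem hyB]
      obtain ⟨⟨y0, y1⟩, y2⟩ := hyB
      rw [m0] at y0
      rcases slab_weight h _ h0 i hi y hy with ⟨_, _, g⟩ | ⟨g', _⟩
      · rcases half_weight _ h1 b y with ⟨_, g1⟩ | ⟨g1, _⟩
        · rcases half_weight _ h2 c y with ⟨_, g2⟩ | ⟨g2, _⟩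
          · rw [g, g1, g2]; simp
          · exact absurd y2 g2
        · exact absurd y1 g1
      · exact absurd y0 g'
    · rw [Set.indicator_of_notMem hyB]
      rcases slab_weight h _ h0 i hi y hy with ⟨ga, gb, _⟩ | ⟨_, g⟩
      · rcases half_weight _ h1 b y with ⟨g1, _⟩ | ⟨_, g1⟩
        · rcases half_weight _ h2 c y with ⟨g2, _⟩ | ⟨_, g2⟩
          · exact absurd ⟨⟨m0.2 ⟨ga, gb⟩, g1⟩, g2⟩ hyB
          · rw [g2]; simp
        · rw [g1]; simp
      · rw [g]; simp
  rw [e, integral_indicator_one hBm] at hI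
  have hr : (μ B).toReal = (μ Set.univ / 20).toReal := by
    rw [ENNReal.toReal_div]
    simpa [Measure.real] using hI
  exact (ENNReal.toReal_eq_toReal_iff' (measure_ne_top _ _)
    (ENNReal.div_ne_top (measure_ne_top _ _) (by norm_num))).1 hr

theorem main {μ : Measure E7} (h : Good μ) :
    ∃ (u v w : EuclideanSpace ℝ (Fin 7)) (t : ℕ → ℝ) (s₁ s₂ : ℝ),
      ‖u‖ = 1 ∧ ‖v‖ = 1 ∧ ‖w‖ = 1 ∧
      StrictMonoOn t (Set.Icc 1 4) ∧
      ∀ i ≤ 4, ∀ b₁ b₂ : Bool,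
        μ (slab u t 4 i ∩ halfSp v s₁ b₁ ∩ halfSp w s₂ b₂) =
          μ Set.univ / 20 := by
  obtain ⟨x, h0, h1, h2, hz⟩ := exists_zero h
  have hI := fun i hi b c => box_int h x h0 h1 h2 i hi (hz i hi).1 (hz i hi).2.1 (hz i hi).2.2 b c
  have hv : toU (x 1) ≠ 0 := by
    apply toU_ne_zero_of h _ h1 (fun b y => (qq μ (toU (x 0)) 0 y - qq μ (toU (x 0)) (0 + 1) y) *
      hw true (gg (x 2) y))
    intro b
    rw [← hI 0 (by norm_num) b true]
    congr 1; funext y; ring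
  have hw' : toU (x 2) ≠ 0 := by
    apply toU_ne_zero_of h _ h2 (fun b y => (qq μ (toU (x 0)) 0 y - qq μ (toU (x 0)) (0 + 1) y) *
      hw true (gg (x 1) y))
    intro b
    rw [← hI 0 (by norm_num) true b]
    congr 1; funext y; ring
  refine ⟨‖toU (x 0)‖⁻¹ • toU (x 0), ‖toU (x 1)‖⁻¹ • toU (x 1), ‖toU (x 2)‖⁻¹ • toU (x 2),
    fun k => ‖toU (x 0)‖⁻¹ * Tq μ (toU (x 0)) k, ‖toU (x 1)‖⁻¹ * x 1 (Fin.last 7),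
    ‖toU (x 2)‖⁻¹ * x 2 (Fin.last 7), norm_smul_inv_norm h0, norm_smul_inv_norm hv,
    norm_smul_inv_norm hw', ?_, ?_⟩
  · intro k hk k' hk' hkk
    have hp : 0 < ‖toU (x 0)‖⁻¹ := inv_pos.2 (norm_pos_iff.2 h0)
    exact mul_lt_mul_of_pos_left (Tq_mono h _ h0 k k' hk.1 hkk hk'.2) hp
  · intro i hi b c
    exact box_measure h x h0 hv hw' i hi b c (hI i hi b c)

theorem not_par {u v : E7} {t : ℕ → ℝ} {s : ℝ} (ht : StrictMonoOn t (Set.Icc 1 4))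
    (hn : ∀ i ≤ 4, ∀ b, (slab u t 4 i ∩ halfSp v s b).Nonempty) : v ≠ u ∧ v ≠ -u := by
  have h14 : t 1 < t 4 := ht (by simp) (by simp) (by norm_num)
  obtain ⟨a, a1, a2⟩ := hn 0 (by norm_num) true
  obtain ⟨b, b1, b2⟩ := hn 0 (by norm_num) false
  obtain ⟨c, c1, c2⟩ := hn 4 (by norm_num) true
  obtain ⟨d, d1, d2⟩ := hn 4 (by norm_num) false
  have a3 := a1.2 (by norm_num)
  have b3 := b1.2 (by norm_num)
  have c3 := c1.1 (by norm_num)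
  have d3 := d1.1 (by norm_num)
  rw [mem_half] at a2 b2 c2 d2
  simp only [if_true, Bool.false_eq_true, if_false, zero_add] at a2 b2 c2 d2 a3 b3 c3 d3
  constructor
  · rintro rfl
    linarith
  · rintro rfl
    rw [inner_neg_right] at a2 b2 c2 d2
    linarith

theorem not_par' {v w : E7} {s s' : ℝ}
    (hn : ∀ b c, (halfSp v s b ∩ halfSp w s' c).Nonempty) : w ≠ v ∧ w ≠ -v := by
  obtain ⟨a, a1, a2⟩ := hn true true
  obtain ⟨b, b1, b2⟩ := hn true false
  obtain ⟨c, c1, c2⟩ := hn false true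
  obtain ⟨d, d1, d2⟩ := hn false false
  rw [mem_half] at a1 b1 c1 d1 a2 b2 c2 d2
  simp only [if_true, Bool.false_eq_true, if_false] at a1 b1 c1 d1 a2 b2 c2 d2
  constructor
  · rintro rfl
    linarith
  · rintro rfl
    rw [inner_neg_right] at a2 b2 c2 d2
    linarith

theorem good_of (μ : Measure E7) (f : E7 → ℝ)
    (hμ : ∀ A : Set E7, MeasurableSet A → μ A = ENNReal.ofReal (∫ x in A, f x))
    (hpos : ∀ U : Set E7, IsOpen U → U.Nonempty → 0 < μ U) : Good μ where
  fin := ⟨by rw [hμ _ MeasurableSet.univ]; exact ENNReal.ofReal_lt_top⟩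
  ac := Measure.AbsolutelyContinuous.mk fun A hA h0 => by
    rw [hμ A hA, setIntegral_measure_zero _ h0, ENNReal.ofReal_zero]
  pos := hpos

end EQ

/-- Every mass distribution in `ℝ^7` admits an equipartition into `20` boxes
by a collection of `4` parallel hyperplanes and two additional non-parallel
hyperplanes. -/
theorem equipartition_R7_20_boxes
    (μ : Measure (EuclideanSpace ℝ (Fin 7)))
    (f : EuclideanSpace ℝ (Fin 7) → ℝ) (hf : Integrable f)
    (hμ : ∀ A : Set (EuclideanSpace ℝ (Fin 7)), MeasurableSet A →
      μ A = ENNReal.ofReal (∫ x in A, f x))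
    (hpos : ∀ U : Set (EuclideanSpace ℝ (Fin 7)), IsOpen U → U.Nonempty → 0 < μ U) :
    ∃ (u v w : EuclideanSpace ℝ (Fin 7)) (t : ℕ → ℝ) (s₁ s₂ : ℝ),
      ‖u‖ = 1 ∧ ‖v‖ = 1 ∧ ‖w‖ = 1 ∧
      v ≠ u ∧ v ≠ -u ∧ w ≠ u ∧ w ≠ -u ∧ w ≠ v ∧ w ≠ -v ∧
      StrictMonoOn t (Set.Icc 1 4) ∧
      ∀ i ≤ 4, ∀ b₁ b₂ : Bool,
        μ (slab u t 4 i ∩ halfSp v s₁ b₁ ∩ halfSp w s₂ b₂) =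
          μ Set.univ / 20 := by
  have h := EQ.good_of μ f hμ hpos
  obtain ⟨u, v, w, t, s₁, s₂, hu, hv, hw, ht, hbox⟩ := EQ.main h
  have hne : ∀ i ≤ 4, ∀ b c,
      (slab u t 4 i ∩ halfSp v s₁ b ∩ halfSp w s₂ c).Nonempty := by
    intro i hi b c
    apply nonempty_of_measure_ne_zero (μ := μ)
    rw [hbox i hi b c]
    apply (ENNReal.div_pos (hpos Set.univ isOpen_univ Set.univ_nonempty).ne' (by norm_num)).ne'
  have p1 := EQ.not_par (u := u) (v := v) (s := s₁) ht fun i hi b =>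
    (hne i hi b true).mono Set.inter_subset_left
  have p2 := EQ.not_par (u := u) (v := w) (s := s₂) ht fun i hi c =>
    (hne i hi true c).mono fun y hy => ⟨hy.1.1, hy.2⟩
  have p3 := EQ.not_par' (v := v) (w := w) (s := s₁) (s' := s₂) fun b c =>
    (hne 0 (by norm_num) b c).mono fun y hy => ⟨hy.1.2, hy.2⟩
  exact ⟨u, v, w, t, s₁, s₂, hu, hv, hw, p1.1, p1.2, p2.1, p2.2, p3.1, p3.2, ht, hbox⟩
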